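/- arXiv:2311.08003 — 2 statements merged into one kernel-verified Lean document; each statement's English description precedes it below -/
import Mathlib

section
/- Let (Q,R) be a gentle presentation with B finite (a finite-dimensional gentle presentation), and write H^m for the degree-m cohomology of the complex k(Γ∥B). (1) The number N of rotation-classes of primitive complete cycles in (Q,R) is finite, and dim H^m ≤ 2N whenever m > |Q_1|; in particular the sequence (dim H^m)_{m≥0} is bounded. (2) If there exists an integer m > |Q_1| with H^m ≠ 0, then there exist infinitely many integers m' > |Q_1| with H^{m'} ≠ 0. -/
/-!
Common framework: quivers, paths (as a start vertex together with a list of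
composable arrows, listed in order of traversal, so that the paper's path
`c_m ⋯ c_1` corresponds to the list `[c_1, …, c_m]`), gentle and quadratic
monomial presentations, the cochain complex `k(Γ ∥ B)` and the chain complex
`k(B ⊙ Γ)` of the paper.
-/

namespace GentleTT

structure Quiv where
  V : Type
  A : Type
  [fintV : Fintype V]
  [fintA : Fintype A]
  [decV : DecidableEq V]
  [decA : DecidableEq A]
  src : A → V
  tgt : A → V

attribute [instance] Quiv.fintV Quiv.fintA Quiv.decV Quiv.decA

/-- A "path datum": a start vertex together with the list of arrows traversed. -/
abbrev PathDat (Q : Quiv) := Q.V × List Q.A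

def psrc (Q : Quiv) (p : PathDat Q) : Q.V := p.1

def ptgt (Q : Quiv) (p : PathDat Q) : Q.V := p.2.getLast?.elim p.1 Q.tgt

def plen (Q : Quiv) (p : PathDat Q) : ℕ := p.2.length

/-- `p` is a genuine path: consecutive arrows compose, and the recorded start
vertex is the source of the first arrow (if any). -/
def Ok (Q : Quiv) (p : PathDat Q) : Prop :=
  p.2.Chain' (fun a b => Q.tgt a = Q.src b) ∧ ∀ a ∈ p.2.head?, Q.src a = p.1

/-- `p` is a path none of whose length-2 subpaths lies in `R`
(an element of the basis `B` of `kQ/⟨R⟩`). -/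
def InB (Q : Quiv) (R : Set (Q.A × Q.A)) (p : PathDat Q) : Prop :=
  Ok Q p ∧ p.2.Chain' (fun a b => (a, b) ∉ R)

/-- `p` is a path all of whose length-2 subpaths lie in `R` (an element of `Γ`). -/
def InG (Q : Quiv) (R : Set (Q.A × Q.A)) (p : PathDat Q) : Prop :=
  Ok Q p ∧ p.2.Chain' (fun a b => (a, b) ∈ R)

/-- Parallel paths: same source and same target. -/
def Par (Q : Quiv) (p q : PathDat Q) : Prop :=
  psrc Q p = psrc Q q ∧ ptgt Q p = ptgt Q q

/-- Antiparallel paths: `s(p) = t(q)` and `t(p) = s(q)`. -/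
def AntiPar (Q : Quiv) (p q : PathDat Q) : Prop :=
  psrc Q p = ptgt Q q ∧ ptgt Q p = psrc Q q

/-- A cycle: a path of positive length whose source equals its target. -/
def IsCycle (Q : Quiv) (p : PathDat Q) : Prop :=
  Ok Q p ∧ p.2 ≠ [] ∧ psrc Q p = ptgt Q p

/-- Rotation of a cycle: the paper's `rot (c_m ⋯ c_1) = c_{m-1} ⋯ c_1 c_m`
(the last arrow traversed becomes the first one traversed). -/
def rotP (Q : Quiv) (p : PathDat Q) : PathDat Q :=
  match p.2.getLast? with
  | none => p
  | some a => (Q.src a, a :: p.2.dropLast)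

/-- Iterated rotation `rot^i`. -/
def rotI (Q : Quiv) (i : ℕ) (p : PathDat Q) : PathDat Q := (rotP Q)^[i] p

def powL {α : Type} (l : List α) : ℕ → List α
  | 0 => []
  | n + 1 => l ++ powL l n

/-- The `n`-th power `p^n` of a (cyclic) path. -/
def powP (Q : Quiv) (p : PathDat Q) (n : ℕ) : PathDat Q := (p.1, powL p.2 n)

/-- A primitive cycle: a cycle that is not a proper power of another cycle. -/
def IsPrimitive (Q : Quiv) (p : PathDat Q) : Prop :=
  IsCycle Q p ∧ ∀ (q : PathDat Q) (n : ℕ), IsCycle Q q → 2 ≤ n → p ≠ powP Q q n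

/-- The period of a cycle: the least `i ≥ 1` with `rot^i p = p`. -/
noncomputable def periodP (Q : Quiv) (p : PathDat Q) : ℕ :=
  sInf {i : ℕ | 1 ≤ i ∧ rotI Q i p = p}

/-- Two cycles are conjugate (belong to the same circuit) if one is obtained
from the other by iterated rotation. -/
def RotEquiv (Q : Quiv) (p q : PathDat Q) : Prop := ∃ i : ℕ, rotI Q i p = q

/-- A cocomplete cycle: `p² ∈ B`. -/
def Cocomplete (Q : Quiv) (R : Set (Q.A × Q.A)) (p : PathDat Q) : Prop :=
  IsCycle Q p ∧ InB Q R (powP Q p 2)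

/-- A complete cycle: `p² ∈ Γ`. -/
def Complete (Q : Quiv) (R : Set (Q.A × Q.A)) (p : PathDat Q) : Prop :=
  IsCycle Q p ∧ InG Q R (powP Q p 2)

/-- `B`-maximal path: in `B` and not a proper subpath of another element of `B`. -/
def BMax (Q : Quiv) (R : Set (Q.A × Q.A)) (p : PathDat Q) : Prop :=
  InB Q R p ∧ ∀ q : PathDat Q, InB Q R q → p.2 <:+: q.2 → p.2 = q.2

/-- `Γ`-maximal path: in `Γ` and not a proper subpath of another element of `Γ`. -/
def GMax (Q : Quiv) (R : Set (Q.A × Q.A)) (p : PathDat Q) : Prop :=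
  InG Q R p ∧ ∀ q : PathDat Q, InG Q R q → p.2 <:+: q.2 → p.2 = q.2

def Adj (Q : Quiv) (v w : Q.V) : Prop :=
  ∃ a : Q.A, (Q.src a = v ∧ Q.tgt a = w) ∨ (Q.src a = w ∧ Q.tgt a = v)

/-- Connectedness of the underlying graph of the quiver. -/
def Connected (Q : Quiv) : Prop := ∀ v w : Q.V, Relation.ReflTransGen (Adj Q) v w

/-- A quadratic monomial presentation: the relations are paths of length 2. -/
def IsQuadMon (Q : Quiv) (R : Set (Q.A × Q.A)) : Prop :=
  ∀ r ∈ R, Q.tgt r.1 = Q.src r.2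

/-- A gentle presentation. -/
structure IsGentle (Q : Quiv) (R : Set (Q.A × Q.A)) : Prop where
  nonempty : Nonempty Q.V
  connected : Connected Q
  relComposable : ∀ r ∈ R, Q.tgt r.1 = Q.src r.2
  srcLe : ∀ v : Q.V, {a : Q.A | Q.src a = v}.ncard ≤ 2
  tgtLe : ∀ v : Q.V, {a : Q.A | Q.tgt a = v}.ncard ≤ 2
  uniqNotRelAfter : ∀ a : Q.A, {b : Q.A | Q.tgt a = Q.src b ∧ (a, b) ∉ R}.Subsingleton
  uniqNotRelBefore : ∀ a : Q.A, {c : Q.A | Q.tgt c = Q.src a ∧ (c, a) ∉ R}.Subsingleton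
  uniqRelAfter : ∀ a : Q.A, {b : Q.A | Q.tgt a = Q.src b ∧ (a, b) ∈ R}.Subsingleton
  uniqRelBefore : ∀ a : Q.A, {c : Q.A | Q.tgt c = Q.src a ∧ (c, a) ∈ R}.Subsingleton

/-- A spanning tree of the (finite, connected) quiver `Q`: a set of arrows
which connects all vertices and has exactly `|Q₀| - 1` elements. -/
def IsSpanningTree (Q : Quiv) (T : Set Q.A) : Prop :=
  (∀ v w : Q.V, Relation.ReflTransGen
      (fun x y => ∃ a ∈ T, (Q.src a = x ∧ Q.tgt a = y) ∨ (Q.src a = y ∧ Q.tgt a = x)) v w) ∧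
  T.ncard + 1 = Fintype.card Q.V

/-- A set of representatives, one for each rotation class of cycles
satisfying `Pred`. -/
def IsRepSet (Q : Quiv) (P : Set (PathDat Q)) (Pred : PathDat Q → Prop) : Prop :=
  (∀ p ∈ P, Pred p) ∧ ∀ q : PathDat Q, Pred q → ∃! p, p ∈ P ∧ RotEquiv Q q p

/-- `S` is a valid choice of the paper's set `Crep` for the predicate `Pred`
(e.g. cocompleteness, or completeness): it consists of all positive powers of a
chosen set of representatives of the rotation classes of primitive cycles
satisfying `Pred`. -/
def IsCrep (Q : Quiv) (S : Set (PathDat Q)) (Pred : PathDat Q → Prop) : Prop :=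
  ∃ P : Set (PathDat Q),
    IsRepSet Q P (fun p => IsPrimitive Q p ∧ Pred p) ∧
    S = {x | ∃ p ∈ P, ∃ n : ℕ, 1 ≤ n ∧ x = powP Q p n}

/-! ### The cochain complex `k(Γ ∥ B)` -/

/-- Membership in the degree-`m` basis `Γ_m ∥ B` of the cochain complex. -/
def GBmem (Q : Quiv) (R : Set (Q.A × Q.A)) (m : ℕ) (x : PathDat Q × PathDat Q) : Prop :=
  InG Q R x.1 ∧ plen Q x.1 = m ∧ InB Q R x.2 ∧ Par Q x.1 x.2

abbrev GB (Q : Quiv) (R : Set (Q.A × Q.A)) (m : ℕ) :=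
  {x : PathDat Q × PathDat Q // GBmem Q R m x}

/-- The degree-`m` component of the cochain complex `k(Γ ∥ B)`. -/
abbrev Coch (k : Type) [Field k] (Q : Quiv) (R : Set (Q.A × Q.A)) (m : ℕ) :=
  GB Q R m →₀ k

/-- The basis vector of `k(Γ_m ∥ B)` attached to a raw pair of path data
(and `0` if the pair is not in `Γ_m ∥ B`). -/
noncomputable def bv (k : Type) [Field k] (Q : Quiv) (R : Set (Q.A × Q.A)) (m : ℕ)
    (x : PathDat Q × PathDat Q) : Coch k Q R m := by
  classical
  exact if h : GBmem Q R m x then Finsupp.single (⟨x, h⟩ : GB Q R m) (1 : k) else 0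

/-- Extension on the left (in the paper's notation): `p ↦ b p`. -/
def extL (Q : Quiv) (b : Q.A) (p : PathDat Q) : PathDat Q := (p.1, p.2 ++ [b])

/-- Extension on the right (in the paper's notation): `p ↦ p a`. -/
def extR (Q : Quiv) (a : Q.A) (p : PathDat Q) : PathDat Q := (Q.src a, a :: p.2)

/-- The differential on a basis element:
`d^m (γ, α) = Σ_b (bγ, bα) - (-1)^m Σ_a (γa, αa)`. -/
noncomputable def dB (k : Type) [Field k] (Q : Quiv) (R : Set (Q.A × Q.A)) (m : ℕ)
    (x : GB Q R m) : Coch k Q R (m + 1) := by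
  classical
  exact
    (∑ b : Q.A,
      if h : GBmem Q R (m + 1) (extL Q b x.val.1, extL Q b x.val.2) then
        Finsupp.single (⟨_, h⟩ : GB Q R (m + 1)) (1 : k) else 0)
    - ((-1 : k) ^ m) •
      (∑ a : Q.A,
        if h : Q.tgt a = psrc Q x.val.1 ∧
            GBmem Q R (m + 1) (extR Q a x.val.1, extR Q a x.val.2) then
          Finsupp.single (⟨_, h.2⟩ : GB Q R (m + 1)) (1 : k) else 0)

/-- The differential `d^m : k(Γ_m ∥ B) → k(Γ_{m+1} ∥ B)`. -/
noncomputable def dLin (k : Type) [Field k] (Q : Quiv) (R : Set (Q.A × Q.A)) (m : ℕ) :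
    Coch k Q R m →ₗ[k] Coch k Q R (m + 1) :=
  Finsupp.linearCombination k (dB k Q R m)

/-- The element `𝟙 = Σ_{i ∈ Q₀} (e_i, e_i)` (placed in degree `m`; it is the
intended element when `m = 0`). -/
noncomputable def oneD (k : Type) [Field k] (Q : Quiv) (R : Set (Q.A × Q.A)) (m : ℕ) :
    Coch k Q R m :=
  ∑ i : Q.V, bv k Q R m ((i, []), (i, []))

/-- `⟨α⟩ = Σ_{i=0}^{r-1} (s(rot^i α), rot^i α)`, `r` the period of `α`. -/
noncomputable def cycB (k : Type) [Field k] (Q : Quiv) (R : Set (Q.A × Q.A)) (m : ℕ)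
    (α : PathDat Q) : Coch k Q R m :=
  ∑ i ∈ Finset.range (periodP Q α),
    bv k Q R m ((psrc Q (rotI Q i α), []), rotI Q i α)

/-- `⟨C⟩ = Σ_{i=0}^{r-1} (-1)^{i m} (rot^i C, s(rot^i C))`, `r` the period of `C`. -/
noncomputable def cycG (k : Type) [Field k] (Q : Quiv) (R : Set (Q.A × Q.A)) (m : ℕ)
    (C : PathDat Q) : Coch k Q R m :=
  ∑ i ∈ Finset.range (periodP Q C),
    ((-1 : k) ^ (i * m)) • bv k Q R m (rotI Q i C, (psrc Q (rotI Q i C), []))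

/-- The coboundary subspace in degree `m` (zero in degree `0`). -/
noncomputable def cobSp (k : Type) [Field k] (Q : Quiv) (R : Set (Q.A × Q.A)) :
    (m : ℕ) → Submodule k (Coch k Q R m)
  | 0 => ⊥
  | m + 1 => LinearMap.range (dLin k Q R m)

/-- The cocycle subspace in degree `m`. -/
noncomputable def cocSp (k : Type) [Field k] (Q : Quiv) (R : Set (Q.A × Q.A)) (m : ℕ) :
    Submodule k (Coch k Q R m) :=
  LinearMap.ker (dLin k Q R m)

/-- The degree-`m` cohomology `HH^m` of the complex `k(Γ ∥ B)` vanishes: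
every cocycle is a coboundary. -/
def CohomIsZero (k : Type) [Field k] (Q : Quiv) (R : Set (Q.A × Q.A)) (m : ℕ) : Prop :=
  cocSp k Q R m ≤ cobSp k Q R m

/-- The degree-`m` cohomology `HH^m` of the complex `k(Γ ∥ B)` is
finite-dimensional: there is a finite set of cocycles whose classes span it. -/
def CohomFinDim (k : Type) [Field k] (Q : Quiv) (R : Set (Q.A × Q.A)) (m : ℕ) : Prop :=
  ∃ G : Finset (Coch k Q R m), ↑G ⊆ (cocSp k Q R m : Set (Coch k Q R m)) ∧
    cocSp k Q R m ≤ cobSp k Q R m ⊔ Submodule.span k ↑G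

/-- The degree-`m` cohomology `HH^m` of the complex `k(Γ ∥ B)` has dimension at
most `n`: there are `n` cocycles whose classes span it. -/
def CohomDimLe (k : Type) [Field k] (Q : Quiv) (R : Set (Q.A × Q.A)) (m n : ℕ) : Prop :=
  ∃ G : Finset (Coch k Q R m), G.card ≤ n ∧
    ↑G ⊆ (cocSp k Q R m : Set (Coch k Q R m)) ∧
    cocSp k Q R m ≤ cobSp k Q R m ⊔ Submodule.span k ↑G

/-- `Gen` is a basis of the kernel of `d⁰`, i.e. it freely generates `HH⁰`. -/
def FreelyGeneratesKer0 (k : Type) [Field k] (Q : Quiv) (R : Set (Q.A × Q.A))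
    (Gen : Set (Coch k Q R 0)) : Prop :=
  (∀ x ∈ Gen, dLin k Q R 0 x = 0) ∧
  (∀ z : Coch k Q R 0, dLin k Q R 0 z = 0 → z ∈ Submodule.span k Gen) ∧
  LinearIndependent k (fun x : Gen => (x : Coch k Q R 0))

/-- The cohomology classes of the elements of `Gen` freely generate the
degree-`(m+1)` cohomology of `k(Γ ∥ B)`: all elements of `Gen` are cocycles,
every cocycle is congruent to an element of their span modulo coboundaries, no
nonzero element of their span is a coboundary, and `Gen` is linearly
independent. -/
def FreelyGeneratesCohom (k : Type) [Field k] (Q : Quiv) (R : Set (Q.A × Q.A)) (m : ℕ)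
    (Gen : Set (Coch k Q R (m + 1))) : Prop :=
  (∀ x ∈ Gen, dLin k Q R (m + 1) x = 0) ∧
  (∀ z : Coch k Q R (m + 1), dLin k Q R (m + 1) z = 0 →
      ∃ y : Coch k Q R m, z - dLin k Q R m y ∈ Submodule.span k Gen) ∧
  (∀ x ∈ Submodule.span k Gen, x ∈ LinearMap.range (dLin k Q R m) → x = 0) ∧
  LinearIndependent k (fun x : Gen => (x : Coch k Q R (m + 1)))

/-! ### The chain complex `k(B ⊙ Γ)` -/

/-- Membership in the degree-`m` basis `B ⊙ Γ_m` of the chain complex. -/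
def BGmem (Q : Quiv) (R : Set (Q.A × Q.A)) (m : ℕ) (x : PathDat Q × PathDat Q) : Prop :=
  InB Q R x.1 ∧ InG Q R x.2 ∧ plen Q x.2 = m ∧ AntiPar Q x.1 x.2

abbrev BGt (Q : Quiv) (R : Set (Q.A × Q.A)) (m : ℕ) :=
  {x : PathDat Q × PathDat Q // BGmem Q R m x}

/-- The degree-`m` component of the chain complex `k(B ⊙ Γ)`. -/
abbrev Chn (k : Type) [Field k] (Q : Quiv) (R : Set (Q.A × Q.A)) (m : ℕ) :=
  BGt Q R m →₀ k

/-- The basis vector of `k(B ⊙ Γ_m)` attached to a raw pair of path data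
(and `0` if the pair is not in `B ⊙ Γ_m`). -/
noncomputable def bw (k : Type) [Field k] (Q : Quiv) (R : Set (Q.A × Q.A)) (m : ℕ)
    (x : PathDat Q × PathDat Q) : Chn k Q R m := by
  classical
  exact if h : BGmem Q R m x then Finsupp.single (⟨x, h⟩ : BGt Q R m) (1 : k) else 0

/-- `l1(p)`: the last arrow of `p` (as a path of length one). -/
def l1P (Q : Quiv) (p : PathDat Q) : PathDat Q :=
  match p.2.getLast? with
  | none => p
  | some a => (Q.src a, [a])

/-- `l2(p)`: `p` with its last arrow removed. -/
def l2P (Q : Quiv) (p : PathDat Q) : PathDat Q := (p.1, p.2.dropLast)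

/-- `r1(p)`: `p` with its first arrow removed. -/
def r1P (Q : Quiv) (p : PathDat Q) : PathDat Q :=
  match p.2 with
  | [] => p
  | a :: l => (Q.tgt a, l)

/-- `r2(p)`: the first arrow of `p` (as a path of length one). -/
def r2P (Q : Quiv) (p : PathDat Q) : PathDat Q :=
  match p.2 with
  | [] => p
  | a :: _ => (Q.src a, [a])

/-- The raw first term `(α·l1(γ), l2(γ))` of the boundary of `(α, γ)`. -/
def d1raw (Q : Quiv) (x : PathDat Q × PathDat Q) : PathDat Q × PathDat Q :=
  match x.2.2.getLast? with
  | none => x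
  | some a => ((Q.src a, a :: x.1.2), (x.2.1, x.2.2.dropLast))

/-- The raw second term `(r2(γ)·α, r1(γ))` of the boundary of `(α, γ)`. -/
def d2raw (Q : Quiv) (x : PathDat Q × PathDat Q) : PathDat Q × PathDat Q :=
  match x.2.2 with
  | [] => x
  | c :: l => ((x.1.1, x.1.2 ++ [c]), (Q.tgt c, l))

/-- The boundary of a basis element:
`d_m (α, γ) = (α·l1(γ), l2(γ)) + (-1)^m (r2(γ)·α, r1(γ))` (in degree `m = m+1`),
where pairs whose first component is not in `B` are interpreted as `0`. -/
noncomputable def bdB (k : Type) [Field k] (Q : Quiv) (R : Set (Q.A × Q.A)) (m : ℕ)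
    (x : BGt Q R (m + 1)) : Chn k Q R m :=
  bw k Q R m (d1raw Q x.val) + ((-1 : k) ^ (m + 1)) • bw k Q R m (d2raw Q x.val)

/-- The boundary map `d_{m+1} : k(B ⊙ Γ_{m+1}) → k(B ⊙ Γ_m)`. -/
noncomputable def bd (k : Type) [Field k] (Q : Quiv) (R : Set (Q.A × Q.A)) (m : ℕ) :
    Chn k Q R (m + 1) →ₗ[k] Chn k Q R m :=
  Finsupp.linearCombination k (bdB k Q R m)

/-- The subspace of cycles in degree `m` (everything in degree `0`). -/
noncomputable def ZSp (k : Type) [Field k] (Q : Quiv) (R : Set (Q.A × Q.A)) :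
    (m : ℕ) → Submodule k (Chn k Q R m)
  | 0 => ⊤
  | m + 1 => LinearMap.ker (bd k Q R m)

/-- The subspace of boundaries in degree `m`. -/
noncomputable def BSp (k : Type) [Field k] (Q : Quiv) (R : Set (Q.A × Q.A)) (m : ℕ) :
    Submodule k (Chn k Q R m) :=
  LinearMap.range (bd k Q R m)

/-- The degree-`m` homology `HH_m` of the complex `k(B ⊙ Γ)` vanishes:
every cycle is a boundary. -/
def HomIsZero (k : Type) [Field k] (Q : Quiv) (R : Set (Q.A × Q.A)) (m : ℕ) : Prop :=
  ZSp k Q R m ≤ BSp k Q R m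

/-- The degree-`m` homology `HH_m` of the complex `k(B ⊙ Γ)` is
finite-dimensional: there is a finite set of cycles whose classes span it. -/
def HomFinDim (k : Type) [Field k] (Q : Quiv) (R : Set (Q.A × Q.A)) (m : ℕ) : Prop :=
  ∃ G : Finset (Chn k Q R m), ↑G ⊆ (ZSp k Q R m : Set (Chn k Q R m)) ∧
    ZSp k Q R m ≤ BSp k Q R m ⊔ Submodule.span k ↑G

/-- The concatenation `α γ` of an antiparallel pair (a cycle, or a trivial path). -/
def concatP (Q : Quiv) (x : PathDat Q × PathDat Q) : PathDat Q := (x.2.1, x.2.2 ++ x.1.2)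

/-- The degree-`m` component of the subcomplex `k(B ⊙ Γ)_C`, spanned by the
basis elements whose concatenation lies in the circuit (rotation class) of `c`. -/
noncomputable def Wsp (k : Type) [Field k] (Q : Quiv) (R : Set (Q.A × Q.A))
    (c : PathDat Q) (m : ℕ) : Submodule k (Chn k Q R m) :=
  Submodule.span k {z : Chn k Q R m |
    ∃ x : BGt Q R m, RotEquiv Q (concatP Q x.val) c ∧ z = Finsupp.single x (1 : k)}

/-- The boundaries of the subcomplex `k(B ⊙ Γ)_C` in degree `m`. -/
noncomputable def WB (k : Type) [Field k] (Q : Quiv) (R : Set (Q.A × Q.A))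
    (c : PathDat Q) (m : ℕ) : Submodule k (Chn k Q R m) :=
  Submodule.map (bd k Q R m) (Wsp k Q R c (m + 1))

/-- The cycles of the subcomplex `k(B ⊙ Γ)_C` in degree `m`. -/
noncomputable def WZ (k : Type) [Field k] (Q : Quiv) (R : Set (Q.A × Q.A))
    (c : PathDat Q) (m : ℕ) : Submodule k (Chn k Q R m) :=
  ZSp k Q R m ⊓ Wsp k Q R c m

/-- The degree-`m` homology of `k(B ⊙ Γ)_C` is one-dimensional, spanned by the
homology class of `v`. -/
def SubHomSpannedBy (k : Type) [Field k] (Q : Quiv) (R : Set (Q.A × Q.A))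
    (c : PathDat Q) (m : ℕ) (v : Chn k Q R m) : Prop :=
  v ∈ WZ k Q R c m ∧ v ∉ WB k Q R c m ∧
  ∀ z ∈ WZ k Q R c m, ∃ t : k, z - t • v ∈ WB k Q R c m

/-- `ĥ(c) = Σ_{i=0}^{r-1} (r1(rot^i c), r2(rot^i c))` (degree 1, for cocomplete cycles;
placed in degree `m`). -/
noncomputable def hCycR (k : Type) [Field k] (Q : Quiv) (R : Set (Q.A × Q.A)) (m : ℕ)
    (c : PathDat Q) : Chn k Q R m :=
  ∑ i ∈ Finset.range (periodP Q c),
    bw k Q R m (r1P Q (rotI Q i c), r2P Q (rotI Q i c))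

/-- `ĥ(c) = Σ_{i=0}^{r-1} (-1)^{(m+1) i} (s(rot^i c), rot^i c)` (degree `m`, for
complete cycles of length `m`). -/
noncomputable def hCycM (k : Type) [Field k] (Q : Quiv) (R : Set (Q.A × Q.A)) (m : ℕ)
    (c : PathDat Q) : Chn k Q R m :=
  ∑ i ∈ Finset.range (periodP Q c),
    ((-1 : k) ^ ((m + 1) * i)) • bw k Q R m ((psrc Q (rotI Q i c), []), rotI Q i c)

/-- The homology classes of the elements of `Gen` freely generate the degree-`m`
homology of `k(B ⊙ Γ)`. -/
def FreelyGeneratesHom (k : Type) [Field k] (Q : Quiv) (R : Set (Q.A × Q.A)) (m : ℕ)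
    (Gen : Set (Chn k Q R m)) : Prop :=
  (∀ x ∈ Gen, x ∈ ZSp k Q R m) ∧
  (∀ z ∈ ZSp k Q R m, ∃ y : Chn k Q R (m + 1), z - bd k Q R m y ∈ Submodule.span k Gen) ∧
  (∀ x ∈ Submodule.span k Gen, x ∈ LinearMap.range (bd k Q R m) → x = 0) ∧
  LinearIndependent k (fun x : Gen => (x : Chn k Q R m))


/-! ### Periodic arrows and the successor permutation -/

def Per (Q : Quiv) (R : Set (Q.A × Q.A)) (a : Q.A) : Prop :=
  Relation.TransGen (fun x y => (x, y) ∈ R) a a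

theorem rel_succ_unique {Q : Quiv} {R : Set (Q.A × Q.A)} (hg : IsGentle Q R) {a b c : Q.A}
    (h1 : (a, b) ∈ R) (h2 : (a, c) ∈ R) : b = c :=
  hg.uniqRelAfter a ⟨hg.relComposable _ h1, h1⟩ ⟨hg.relComposable _ h2, h2⟩

theorem rel_pred_unique {Q : Quiv} {R : Set (Q.A × Q.A)} (hg : IsGentle Q R) {a b c : Q.A}
    (h1 : (b, a) ∈ R) (h2 : (c, a) ∈ R) : b = c :=
  hg.uniqRelBefore a ⟨hg.relComposable _ h1, h1⟩ ⟨hg.relComposable _ h2, h2⟩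

theorem per_iff_of_rel {Q : Quiv} {R : Set (Q.A × Q.A)} (hg : IsGentle Q R) {a b : Q.A}
    (h : (a, b) ∈ R) : Per Q R a ↔ Per Q R b := by
  constructor
  · intro ha
    obtain ⟨c, hc, hca⟩ := Relation.TransGen.head'_iff.1 ha
    obtain rfl := rel_succ_unique hg h hc
    exact Relation.TransGen.tail' hca h
  · intro hb
    obtain ⟨c, hbc, hc⟩ := Relation.TransGen.tail'_iff.1 hb
    obtain rfl := rel_pred_unique hg h hc
    exact Relation.TransGen.head' h hbc

theorem exists_perm {Q : Quiv} {R : Set (Q.A × Q.A)} (hg : IsGentle Q R) :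
    ∃ s : Equiv.Perm Q.A, ∀ a, Per Q R a → (a, s a) ∈ R := by
  classical
  have hex : ∀ a, Per Q R a → ∃ b, (a, b) ∈ R := by
    intro a ha
    obtain ⟨c, hc, -⟩ := Relation.TransGen.head'_iff.1 ha
    exact ⟨c, hc⟩
  let f : Q.A → Q.A := fun a => if h : Per Q R a then (hex a h).choose else a
  have hf1 : ∀ a, Per Q R a → (a, f a) ∈ R := by
    intro a ha
    simp only [f, dif_pos ha]
    exact (hex a ha).choose_spec
  have hf2 : ∀ a, ¬ Per Q R a → f a = a := by
    intro a ha
    simp only [f, dif_neg ha]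
  have hinj : Function.Injective f := by
    intro a b hab
    by_cases ha : Per Q R a <;> by_cases hb : Per Q R b
    · have h1 := hf1 a ha
      rw [hab] at h1
      exact rel_pred_unique hg h1 (hf1 b hb)
    · have h1 := (per_iff_of_rel hg (hf1 a ha)).1 ha
      rw [hab, hf2 b hb] at h1
      exact absurd h1 hb
    · have h1 := (per_iff_of_rel hg (hf1 b hb)).1 hb
      rw [← hab, hf2 a ha] at h1
      exact absurd h1 ha
    · rw [hf2 a ha, hf2 b hb] at hab
      exact hab
  exact ⟨Equiv.ofBijective f (Finite.injective_iff_bijective.1 hinj), hf1⟩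

/-- The walk of length `n` along the permutation `s` starting with `a`. -/
def wl {α : Type} (s : Equiv.Perm α) : α → ℕ → List α
  | _, 0 => []
  | a, n + 1 => a :: wl s (s a) n

theorem wl_length {α : Type} (s : Equiv.Perm α) (a : α) (n : ℕ) : (wl s a n).length = n := by
  induction n generalizing a with
  | zero => rfl
  | succ n ih => simp [wl, ih]

theorem wl_snoc {α : Type} (s : Equiv.Perm α) (a : α) (n : ℕ) :
    wl s a (n + 1) = wl s a n ++ [(s ^ n) a] := by
  induction n generalizing a with
  | zero => rfl
  | succ n ih =>
    rw [wl, ih (s a), wl, List.cons_append, pow_succ]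
    rfl

theorem wl_add {α : Type} (s : Equiv.Perm α) (a : α) (n m : ℕ) :
    wl s a (n + m) = wl s a n ++ wl s ((s ^ n) a) m := by
  induction m with
  | zero => simp [wl]
  | succ m ih =>
    rw [← add_assoc, wl_snoc, ih, wl_snoc, List.append_assoc, ← Equiv.Perm.mul_apply, ← pow_add,
      add_comm m n]

theorem wl_getLast? {α : Type} (s : Equiv.Perm α) (a : α) (n : ℕ) :
    (wl s a (n + 1)).getLast? = some ((s ^ n) a) := by
  rw [wl_snoc]; simp

theorem mem_wl {α : Type} (s : Equiv.Perm α) (a : α) (n : ℕ) {x : α} (h : x ∈ wl s a n) :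
    ∃ i : ℕ, x = (s ^ i) a := by
  induction n with
  | zero => simp [wl] at h
  | succ n ih =>
    rw [wl_snoc] at h
    rcases List.mem_append.1 h with h | h
    · exact ih h
    · exact ⟨n, by simpa using h⟩

/-- Standing data: the successor permutation. -/
def IsSucc (Q : Quiv) (R : Set (Q.A × Q.A)) (s : Equiv.Perm Q.A) : Prop :=
  ∀ a, Per Q R a → (a, s a) ∈ R

section
variable {Q : Quiv} {R : Set (Q.A × Q.A)} {s : Equiv.Perm Q.A}

theorem per_s (hg : IsGentle Q R) (hs : IsSucc Q R s) {a : Q.A} (ha : Per Q R a) :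
    Per Q R (s a) := (per_iff_of_rel hg (hs a ha)).1 ha

theorem per_pow (hg : IsGentle Q R) (hs : IsSucc Q R s) {a : Q.A} (ha : Per Q R a) (n : ℕ) :
    Per Q R ((s ^ n) a) := by
  induction n with
  | zero => simpa using ha
  | succ n ih => rw [pow_succ']; exact per_s hg hs ih

theorem per_symm (hg : IsGentle Q R) (hs : IsSucc Q R s) {a : Q.A} (ha : Per Q R a) :
    Per Q R (s.symm a) := by
  have h : s.symm a = (s ^ (orderOf s - 1)) a := by
    rw [Equiv.symm_apply_eq, ← Equiv.Perm.mul_apply, ← pow_succ',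
      Nat.sub_add_cancel (orderOf_pos s), pow_orderOf_eq_one]; rfl
  rw [h]; exact per_pow hg hs ha _

theorem rel_symm (hg : IsGentle Q R) (hs : IsSucc Q R s) {a : Q.A} (ha : Per Q R a) :
    (s.symm a, a) ∈ R := by
  simpa using hs _ (per_symm hg hs ha)

theorem rel_pow (hg : IsGentle Q R) (hs : IsSucc Q R s) {a : Q.A} (ha : Per Q R a) (n : ℕ) :
    ((s ^ n) a, (s ^ (n + 1)) a) ∈ R := by
  rw [pow_succ']; exact hs _ (per_pow hg hs ha n)

theorem wl_chain (hg : IsGentle Q R) (hs : IsSucc Q R s) {a : Q.A} (ha : Per Q R a) (n : ℕ) :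
    (wl s a n).IsChain (fun x y => (x, y) ∈ R) := by
  induction n generalizing a with
  | zero => simp [wl]
  | succ n ih =>
    rw [wl]
    have := ih (per_s hg hs ha)
    cases n with
    | zero => simp [wl]
    | succ n =>
      rw [wl] at this ⊢
      exact List.isChain_cons_cons.2 ⟨hs a ha, this⟩

theorem eq_wl (hg : IsGentle Q R) (hs : IsSucc Q R s) (l : List Q.A) (a : Q.A) (ha : Per Q R a)
    (hl : (a :: l).IsChain (fun x y => (x, y) ∈ R)) : a :: l = wl s a (l.length + 1) := by
  induction l generalizing a with
  | nil => rfl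
  | cons b l ih =>
    obtain ⟨h1, h2⟩ := List.isChain_cons_cons.1 hl
    obtain rfl := rel_succ_unique hg (hs a ha) h1
    rw [List.length_cons, wl, ← ih _ (per_s hg hs ha) h2]

theorem per_of_mem (hg : IsGentle Q R) (l : List Q.A) (a x : Q.A) (hx : x ∈ a :: l)
    (hl : (a :: l).IsChain (fun x y => (x, y) ∈ R)) (hp : Per Q R x) : Per Q R a := by
  induction l generalizing a with
  | nil =>
    simp at hx
    exact hx ▸ hp
  | cons b l ih =>
    obtain ⟨h1, h2⟩ := List.isChain_cons_cons.1 hl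
    rcases List.mem_cons.1 hx with rfl | hx
    · exact hp
    · exact (per_iff_of_rel hg h1).2 (ih b hx h2)

theorem gamma_eq (hg : IsGentle Q R) (hs : IsSucc Q R s) (p : PathDat Q) (hp : InG Q R p)
    (n : ℕ) (hn : plen Q p = n) (hc : Fintype.card Q.A < n) :
    ∃ a, Per Q R a ∧ p = (Q.src a, wl s a n) := by
  obtain ⟨v, l⟩ := p
  obtain ⟨⟨h1, h2⟩, h3⟩ := hp
  simp only [plen] at *
  have hnd : ¬ l.Nodup := fun h => by
    have := h.length_le_card
    omega
  have h3' : l.IsChain (Relation.TransGen (fun x y => (x, y) ∈ R)) :=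
    List.IsChain.imp (fun _ _ h => Relation.TransGen.single h) h3
  have h4 : l.Pairwise (Relation.TransGen (fun x y => (x, y) ∈ R)) :=
    List.isChain_iff_pairwise.1 h3'
  rw [List.nodup_iff_sublist] at hnd
  push Not at hnd
  obtain ⟨x, hx⟩ := hnd
  have hpx : Per Q R x := by
    have := h4.sublist hx
    simpa [Per] using this
  have hxl : x ∈ l := hx.subset (by simp)
  cases l with
  | nil => simp at hxl
  | cons a l =>
    have hpa := per_of_mem hg l a x hxl h3 hpx
    refine ⟨a, hpa, ?_⟩
    have := eq_wl hg hs l a hpa h3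
    rw [← hn, List.length_cons, ← this]
    have := h2 a (by simp)
    rw [this]

end

/-! ### Basis elements along periodic walks -/

section
variable {Q : Quiv} {R : Set (Q.A × Q.A)} {s : Equiv.Perm Q.A}

/-- The raw pair `(w(a,n), l)`. -/
def rawP (Q : Quiv) (s : Equiv.Perm Q.A) (n : ℕ) (a : Q.A) (l : List Q.A) :
    PathDat Q × PathDat Q :=
  ((Q.src a, wl s a n), (Q.src a, l))

/-- The pair `(w(a,n), l)` belongs to `Γ_n ∥ B`. -/
abbrev Good (Q : Quiv) (R : Set (Q.A × Q.A)) (s : Equiv.Perm Q.A) (n : ℕ) (a : Q.A)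
    (l : List Q.A) : Prop := GBmem Q R n (rawP Q s n a l)

theorem good_iff (hg : IsGentle Q R) (hs : IsSucc Q R s) {a : Q.A} (ha : Per Q R a) (m : ℕ)
    (l : List Q.A) :
    Good Q R s (m + 1) a l ↔
      (l.IsChain (fun a b => Q.tgt a = Q.src b) ∧ ∀ x ∈ l.head?, Q.src x = Q.src a) ∧
      l.IsChain (fun a b => (a, b) ∉ R) ∧
      l.getLast?.elim (Q.src a) Q.tgt = Q.tgt ((s ^ m) a) := by
  have h1 : InG Q R (Q.src a, wl s a (m + 1)) := by
    refine ⟨⟨?_, ?_⟩, wl_chain hg hs ha _⟩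
    · exact List.IsChain.imp (fun x y h => hg.relComposable (x, y) h) (wl_chain hg hs ha _)
    · simp [wl]
  simp only [Good, GBmem, rawP, plen, InB, Ok, Par, psrc, ptgt, wl_getLast?, wl_length]
  constructor
  · rintro ⟨-, -, ⟨h3, h4⟩, -, h5⟩
    exact ⟨h3, h4, h5.symm⟩
  · rintro ⟨h3, h4, h5⟩
    exact ⟨h1, trivial, ⟨h3, h4⟩, trivial, h5.symm⟩

theorem good_snoc (hg : IsGentle Q R) (hs : IsSucc Q R s) {a : Q.A} (ha : Per Q R a) (m : ℕ)
    (l : List Q.A) (h : Good Q R s (m + 1) a l) (hl : l.getLast? ≠ some ((s ^ m) a)) :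
    Good Q R s (m + 2) a (l ++ [(s ^ (m + 1)) a]) := by
  rw [good_iff hg hs ha] at h ⊢
  obtain ⟨⟨h1, h2⟩, h3, h4⟩ := h
  have hr := rel_pow hg hs ha m
  have hc : Q.tgt ((s ^ m) a) = Q.src ((s ^ (m + 1)) a) := hg.relComposable _ hr
  rcases List.eq_nil_or_concat l with rfl | ⟨l, c, rfl⟩
  · simp at h4 ⊢
    rw [h4, hc]
  · simp only [List.concat_eq_append] at *
    simp at h4 hl
    refine ⟨⟨?_, ?_⟩, ?_, ?_⟩
    · rw [List.isChain_append]
      refine ⟨h1, by simp, ?_⟩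
      simp [h4, hc]
    · intro x hx
      apply h2
      cases l <;> simpa using hx
    · rw [List.isChain_append]
      refine ⟨h3, by simp, ?_⟩
      simp
      intro h5
      exact hl (rel_pred_unique hg h5 hr)
    · simp

theorem good_init (hg : IsGentle Q R) (hs : IsSucc Q R s) {a : Q.A} (ha : Per Q R a) (m : ℕ)
    (l : List Q.A) (h : Good Q R s (m + 2) a (l ++ [(s ^ (m + 1)) a])) :
    Good Q R s (m + 1) a l ∧ l.getLast? ≠ some ((s ^ m) a) := by
  rw [good_iff hg hs ha] at h
  rw [good_iff hg hs ha]
  obtain ⟨⟨h1, h2⟩, h3, h4⟩ := h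
  have hr := rel_pow hg hs ha m
  have hc : Q.tgt ((s ^ m) a) = Q.src ((s ^ (m + 1)) a) := hg.relComposable _ hr
  rcases List.eq_nil_or_concat l with rfl | ⟨l, c, rfl⟩
  · simp at h2 ⊢
    rw [← h2, hc]
  · simp only [List.concat_eq_append] at *
    rw [List.isChain_append] at h1 h3
    obtain ⟨h1, -, h1'⟩ := h1
    obtain ⟨h3, -, h3'⟩ := h3
    simp at h1' h3'
    refine ⟨⟨⟨h1, ?_⟩, h3, ?_⟩, ?_⟩
    · intro x hx
      apply h2
      cases l <;> simpa using hx
    · simp [h1', hc]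
    · simp
      rintro rfl
      exact h3' hr

theorem good_cons (hg : IsGentle Q R) (hs : IsSucc Q R s) {a : Q.A} (ha : Per Q R a) (m : ℕ)
    (l : List Q.A) (h : Good Q R s (m + 1) a l) (hl : l.head? ≠ some a) :
    Good Q R s (m + 2) (s.symm a) (s.symm a :: l) := by
  rw [good_iff hg hs ha] at h
  rw [good_iff hg hs (per_symm hg hs ha)]
  obtain ⟨⟨h1, h2⟩, h3, h4⟩ := h
  have hr := rel_symm hg hs ha
  have hc : Q.tgt (s.symm a) = Q.src a := hg.relComposable _ hr
  have hp : (s ^ (m + 1)) (s.symm a) = (s ^ m) a := by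
    rw [pow_succ]; simp
  rw [hp]
  cases l with
  | nil =>
    simp at h4 ⊢
    rw [hc, h4]
  | cons b l =>
    have h2' := h2 b (by simp)
    simp at hl
    refine ⟨⟨?_, by simp⟩, ?_, ?_⟩
    · rw [List.isChain_cons_cons]
      exact ⟨by rw [hc, h2'], h1⟩
    · rw [List.isChain_cons_cons]
      refine ⟨fun h5 => hl (rel_succ_unique hg h5 hr), h3⟩
    · rw [List.getLast?_cons_cons]
      rw [List.getLast?_eq_some_getLast (by simp)] at h4 ⊢
      exact h4

theorem good_cons_head (hg : IsGentle Q R) (hs : IsSucc Q R s) {a : Q.A} (ha : Per Q R a) (m : ℕ)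
    (l : List Q.A) (h : Good Q R s (m + 2) (s.symm a) (s.symm a :: l)) :
    l.head? ≠ some a := by
  rw [good_iff hg hs (per_symm hg hs ha)] at h
  obtain ⟨-, h3, -⟩ := h
  rw [List.isChain_cons] at h3
  intro hl
  exact h3.1 a (by simp [hl]) (rel_symm hg hs ha)

variable (k : Type) [Field k]

/-- The basis vector of `(w(a,n), l)`. -/
noncomputable def be (R : Set (Q.A × Q.A)) (s : Equiv.Perm Q.A) (n : ℕ) (a : Q.A)
    (l : List Q.A) : Coch k Q R n := bv k Q R n (rawP Q s n a l)

theorem be_of_not_good {n : ℕ} {a : Q.A} {l : List Q.A} (h : ¬ Good Q R s n a l) :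
    be k R s n a l = 0 := by
  unfold be bv
  rw [dif_neg h]

theorem be_of_good {n : ℕ} {a : Q.A} {l : List Q.A} (h : Good Q R s n a l) :
    be k R s n a l = Finsupp.single (⟨rawP Q s n a l, h⟩ : GB Q R n) 1 := by
  unfold be bv
  rw [dif_pos h]

theorem dB_eq (n : ℕ) (x : GB Q R n) :
    dB k Q R n x = ∑ b : Q.A, bv k Q R (n + 1) (extL Q b x.val.1, extL Q b x.val.2)
      - ((-1 : k) ^ n) • ∑ a : Q.A, if Q.tgt a = psrc Q x.val.1 then
          bv k Q R (n + 1) (extR Q a x.val.1, extR Q a x.val.2) else 0 := by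
  classical
  unfold dB bv
  congr 2
  refine Finset.sum_congr rfl fun a _ => ?_
  by_cases h1 : Q.tgt a = psrc Q x.val.1
  · by_cases h2 : GBmem Q R (n + 1) (extR Q a x.val.1, extR Q a x.val.2)
    · rw [dif_pos ⟨h1, h2⟩, if_pos h1, dif_pos h2]
    · rw [dif_neg (fun h => h2 h.2), if_pos h1, dif_neg h2]
  · rw [dif_neg (fun h => h1 h.1), if_neg h1]

open Classical in
theorem d_be (hg : IsGentle Q R) (hs : IsSucc Q R s) {a : Q.A} (ha : Per Q R a) (m : ℕ)
    (l : List Q.A) (h : Good Q R s (m + 1) a l) :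
    dLin k Q R (m + 1) (be k R s (m + 1) a l) =
      (if l.getLast? = some ((s ^ m) a) then 0 else be k R s (m + 2) a (l ++ [(s ^ (m + 1)) a]))
      - ((-1 : k) ^ (m + 1)) •
        (if l.head? = some a then 0 else be k R s (m + 2) (s.symm a) (s.symm a :: l)) := by
  rw [be_of_good k h, dLin, Finsupp.linearCombination_single, one_smul, dB_eq]
  congr 2
  · rw [Finset.sum_eq_single ((s ^ (m + 1)) a)]
    · have : (extL Q ((s ^ (m + 1)) a) (rawP Q s (m + 1) a l).1,
          extL Q ((s ^ (m + 1)) a) (rawP Q s (m + 1) a l).2) =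
          rawP Q s (m + 2) a (l ++ [(s ^ (m + 1)) a]) := by
        simp only [extL, rawP]
        rw [wl_snoc s a (m + 1)]
      simp only [this]
      split_ifs with h1
      · apply be_of_not_good k
        intro h2
        exact (good_init hg hs ha m l h2).2 h1
      · rfl
    · intro b _ hb
      unfold bv
      rw [dif_neg]
      rintro ⟨⟨-, h2⟩, -⟩
      simp only [extL, rawP] at h2
      change List.IsChain _ _ at h2
      rw [List.isChain_append] at h2
      have := h2.2.2 ((s ^ m) a) (by rw [wl_getLast?]; simp) b (by simp)
      exact hb (rel_succ_unique hg this (rel_pow hg hs ha m))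
    · simp
  · rw [Finset.sum_eq_single (s.symm a)]
    · have : (extR Q (s.symm a) (rawP Q s (m + 1) a l).1,
          extR Q (s.symm a) (rawP Q s (m + 1) a l).2) =
          rawP Q s (m + 2) (s.symm a) (s.symm a :: l) := by
        simp only [extR, rawP]
        rw [show wl s (s.symm a) (m + 2) = s.symm a :: wl s (s (s.symm a)) (m + 1) from rfl,
          Equiv.apply_symm_apply]
      simp only [this]
      rw [if_pos (show Q.tgt (s.symm a) = psrc Q (rawP Q s (m + 1) a l).1 from
        hg.relComposable _ (rel_symm hg hs ha))]
      split_ifs with h1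
      · apply be_of_not_good k
        intro h2
        exact good_cons_head hg hs ha m l h2 h1
      · rfl
    · intro b _ hb
      split_ifs
      · unfold bv
        rw [dif_neg]
        rintro ⟨⟨-, h2⟩, -⟩
        simp only [extR, rawP] at h2
        change List.IsChain _ _ at h2
        rw [wl, List.isChain_cons_cons] at h2
        exact hb (rel_pred_unique hg h2.1 (rel_symm hg hs ha))
      · rfl
    · simp

end

/-! ### The contracting homotopy -/

section
variable {Q : Quiv} {R : Set (Q.A × Q.A)} {s : Equiv.Perm Q.A}

theorem rawP_inj {n : ℕ} {a a' : Q.A} {l l' : List Q.A}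
    (h : rawP Q s (n + 1) a l = rawP Q s (n + 1) a' l') : a = a' ∧ l = l' := by
  simp only [rawP, wl, Prod.mk.injEq, List.cons.injEq] at h
  exact ⟨h.1.2.1, h.2.2⟩

theorem good_nil (hg : IsGentle Q R) (hs : IsSucc Q R s) {a : Q.A} (ha : Per Q R a) (m : ℕ)
    (h : (s ^ (m + 1)) a = a) : Good Q R s (m + 1) a [] := by
  rw [good_iff hg hs ha]
  have := hg.relComposable _ (rel_pow hg hs ha m)
  simp only [h] at this
  simp [this]

theorem good_single (hg : IsGentle Q R) (hs : IsSucc Q R s) {a : Q.A} (ha : Per Q R a) (m : ℕ)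
    (h : (s ^ (m + 1)) a = a) : Good Q R s (m + 2) a [a] := by
  have := good_snoc hg hs ha m [] (good_nil hg hs ha m h) (by simp)
  simpa [h] using this

theorem exists_raw (hg : IsGentle Q R) (hs : IsSucc Q R s) {n : ℕ} (hn : Fintype.card Q.A < n)
    (x : GB Q R n) : ∃ a l, Per Q R a ∧ x.val = rawP Q s n a l := by
  obtain ⟨⟨p, q⟩, hx⟩ := x
  obtain ⟨a, ha, h⟩ := gamma_eq hg hs p hx.1 n hx.2.1 hn
  refine ⟨a, q.2, ha, ?_⟩
  have h2 : psrc Q p = psrc Q q := hx.2.2.2.1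
  simp only [rawP, ← h, psrc] at h2 ⊢
  rw [h] at h2
  simp only at h2
  rw [h2]

variable (k : Type) [Field k]

theorem lin_ext (hg : IsGentle Q R) (hs : IsSucc Q R s) {n : ℕ} (hn : Fintype.card Q.A < n)
    {M : Type} [AddCommGroup M] [Module k M] (f g : Coch k Q R n →ₗ[k] M)
    (h : ∀ a l, Per Q R a → Good Q R s n a l → f (be k R s n a l) = g (be k R s n a l)) :
    f = g := by
  apply Finsupp.lhom_ext
  intro x c
  obtain ⟨a, l, ha, hx⟩ := exists_raw hg hs hn x
  obtain ⟨x, hx'⟩ := x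
  subst hx
  have h1 := h a l ha hx'
  rw [be_of_good k hx'] at h1
  rw [← mul_one c, ← smul_eq_mul, ← Finsupp.smul_single, map_smul, map_smul, h1]

open Classical in
/-- The coefficient functional at `(w(a,n), l)`. -/
noncomputable def ev (R : Set (Q.A × Q.A)) (s : Equiv.Perm Q.A) (n : ℕ) (a : Q.A)
    (l : List Q.A) : Coch k Q R n →ₗ[k] k :=
  if h : Good Q R s n a l then Finsupp.lapply (⟨rawP Q s n a l, h⟩ : GB Q R n) else 0

open Classical in
theorem ev_be {n : ℕ} {a a' : Q.A} {l l' : List Q.A} (h : Good Q R s (n + 1) a l) :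
    ev k R s (n + 1) a l (be k R s (n + 1) a' l') = if a' = a ∧ l' = l then 1 else 0 := by
  unfold ev
  rw [dif_pos h]
  split_ifs with h1
  · obtain ⟨rfl, rfl⟩ := h1
    rw [be_of_good k h]
    simp
  · by_cases h2 : Good Q R s (n + 1) a' l'
    · rw [be_of_good k h2, Finsupp.lapply_apply, Finsupp.single_apply, if_neg]
      intro h3
      exact h1 (rawP_inj (Subtype.ext_iff.1 h3))
    · rw [be_of_not_good k h2, map_zero]

open Classical in
noncomputable def hraw (R : Set (Q.A × Q.A)) (s : Equiv.Perm Q.A) (m : ℕ) (a : Q.A)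
    (l : List Q.A) : Coch k Q R (m + 1) :=
  if l.getLast? = some ((s ^ (m + 1)) a) ∧ l ≠ [a] then be k R s (m + 1) a l.dropLast else 0

/-- The homotopy. -/
noncomputable def hom (R : Set (Q.A × Q.A)) (s : Equiv.Perm Q.A) (m : ℕ) :
    Coch k Q R (m + 2) →ₗ[k] Coch k Q R (m + 1) :=
  Finsupp.linearCombination k
    (fun x : GB Q R (m + 2) => x.val.1.2.head?.elim 0 (fun a => hraw k R s m a x.val.2.2))

theorem hom_be {m : ℕ} {a : Q.A} {l : List Q.A} (h : Good Q R s (m + 2) a l) :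
    hom k R s m (be k R s (m + 2) a l) = hraw k R s m a l := by
  rw [be_of_good k h, hom, Finsupp.linearCombination_single, one_smul]
  rfl

/-- The cyclic basis elements in degree `m + 2`. -/
def Cyc (s : Equiv.Perm Q.A) (m : ℕ) (a : Q.A) (l : List Q.A) : Prop :=
  (l = [] ∧ (s ^ (m + 2)) a = a) ∨ (l = [a] ∧ (s ^ (m + 1)) a = a)

open Classical in
theorem homotopy (hg : IsGentle Q R) (hs : IsSucc Q R s) {a : Q.A} (ha : Per Q R a) (m : ℕ)
    (l : List Q.A) (h : Good Q R s (m + 2) a l) :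
    dLin k Q R (m + 1) (hom k R s m (be k R s (m + 2) a l)) +
      hom k R s (m + 1) (dLin k Q R (m + 2) (be k R s (m + 2) a l)) =
    if Cyc s m a l then 0 else be k R s (m + 2) a l := by
  have hp : (s ^ (m + 2)) (s.symm a) = (s ^ (m + 1)) a := by
    rw [pow_succ]; simp
  rw [hom_be k h, d_be k hg hs ha (m + 1) l h, map_sub, map_smul]
  by_cases hl : l.getLast? = some ((s ^ (m + 1)) a)
  · -- shared on the left
    obtain ⟨l', rfl⟩ : ∃ l', l = l' ++ [(s ^ (m + 1)) a] := by
      rcases List.eq_nil_or_concat l with rfl | ⟨l, c, rfl⟩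
      · simp at hl
      · simp at hl
        exact ⟨l, by simp [hl]⟩
    obtain ⟨hi1, hi2⟩ := good_init hg hs ha m l' h
    rw [if_pos hl, map_zero, zero_sub]
    by_cases hla : l' ++ [(s ^ (m + 1)) a] = [a]
    · have h1 : Cyc s m a (l' ++ [(s ^ (m + 1)) a]) := by
        right
        refine ⟨hla, ?_⟩
        have := congrArg List.getLast? hla
        simpa using this
      rw [if_pos h1]
      simp [hraw, hla]
    · have h1 : ¬ Cyc s m a (l' ++ [(s ^ (m + 1)) a]) := by
        rintro (h1 | h1)
        · simp at h1
        · exact hla h1.1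
      rw [if_neg h1, hraw, if_pos ⟨hl, hla⟩, List.dropLast_concat, d_be k hg hs ha m l' hi1,
        if_neg hi2]
      have hh : ((l' ++ [(s ^ (m + 1)) a]).head? = some a) ↔ (l'.head? = some a) := by
        cases l' with
        | nil =>
          simp at hla ⊢
          exact hla
        | cons b l' => simp
      by_cases h2 : l'.head? = some a
      · rw [if_pos h2, if_pos (hh.2 h2)]
        simp
      · rw [if_neg h2, if_neg (fun h3 => h2 (hh.1 h3)),
          hom_be k (good_cons hg hs ha (m + 1) _ h (fun h3 => h2 (hh.1 h3))), hraw, if_pos]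
        · rw [← List.cons_append, List.dropLast_concat, pow_succ (-1 : k) (m + 1)]
          simp
        · constructor
          · rw [← List.cons_append, List.getLast?_concat, hp]
          · simp
  · -- not shared on the left
    rw [if_neg hl, hraw, if_neg (fun h1 => hl h1.1), map_zero, zero_add,
      hom_be k (good_snoc hg hs ha (m + 1) l h hl)]
    have h2 : hom k R s (m + 1) (if l.head? = some a then 0
        else be k R s (m + 3) (s.symm a) (s.symm a :: l)) = 0 := by
      split_ifs with h3
      · simp
      · rw [hom_be k (good_cons hg hs ha (m + 1) l h h3), hraw, if_neg]
        rintro ⟨h4, h5⟩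
        cases l with
        | nil => exact h5 rfl
        | cons b l =>
          rw [List.getLast?_cons_cons, hp] at h4
          exact hl h4
    rw [h2, smul_zero, sub_zero, hraw, List.dropLast_concat, List.getLast?_concat]
    by_cases h3 : Cyc s m a l
    · rw [if_pos h3, if_neg]
      rcases h3 with ⟨rfl, h3⟩ | ⟨rfl, h3⟩
      · rintro ⟨-, h4⟩
        exact h4 (by simp [h3])
      · simp [h3] at hl
    · rw [if_neg h3, if_pos]
      refine ⟨rfl, fun h4 => h3 (Or.inl ?_)⟩
      have h5 : l = [] := by
        have := congrArg List.length h4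
        simpa using this
      subst h5
      exact ⟨rfl, by simpa using h4⟩

open Classical in
/-- The projection onto the cyclic part. -/
noncomputable def pr (R : Set (Q.A × Q.A)) (s : Equiv.Perm Q.A) (m : ℕ) :
    Coch k Q R (m + 2) →ₗ[k] Coch k Q R (m + 2) :=
  Finsupp.linearCombination k
    (fun x : GB Q R (m + 2) => if x.val.1.2.head?.elim False (fun a => Cyc s m a x.val.2.2)
      then Finsupp.single x 1 else 0)

open Classical in
theorem pr_be {m : ℕ} {a : Q.A} {l : List Q.A} (h : Good Q R s (m + 2) a l) :
    pr k R s m (be k R s (m + 2) a l) = if Cyc s m a l then be k R s (m + 2) a l else 0 := by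
  rw [be_of_good k h, pr, Finsupp.linearCombination_single, one_smul]
  rfl

theorem decomp (hg : IsGentle Q R) (hs : IsSucc Q R s) (m : ℕ) (hn : Fintype.card Q.A < m + 2)
    (z : Coch k Q R (m + 2)) :
    z = dLin k Q R (m + 1) (hom k R s m z) + hom k R s (m + 1) (dLin k Q R (m + 2) z)
      + pr k R s m z := by
  classical
  have : LinearMap.id = dLin k Q R (m + 1) ∘ₗ hom k R s m + hom k R s (m + 1) ∘ₗ dLin k Q R (m + 2)
      + pr k R s m := by
    apply lin_ext k hg hs hn
    intro a l ha h
    simp only [LinearMap.id_apply, LinearMap.add_apply, LinearMap.comp_apply]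
    rw [homotopy k hg hs ha m l h, pr_be k h]
    split_ifs <;> simp
  exact congrArg (fun f => f z) this

theorem pr_mem (hg : IsGentle Q R) (hs : IsSucc Q R s) (m : ℕ) (hn : Fintype.card Q.A < m + 2)
    (z : Coch k Q R (m + 2))
    (hz : ∀ a, Per Q R a → (s ^ (m + 2)) a = a → ev k R s (m + 2) a [] z = 0)
    (S : Submodule k (Coch k Q R (m + 2)))
    (hS : ∀ a, Per Q R a → (s ^ (m + 1)) a = a → be k R s (m + 2) a [a] ∈ S) :
    pr k R s m z ∈ S := by
  classical
  rw [pr, Finsupp.linearCombination_apply]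
  apply Submodule.sum_mem
  intro x _
  obtain ⟨a, l, ha, hx⟩ := exists_raw hg hs hn x
  obtain ⟨x, hx'⟩ := x
  subst hx
  beta_reduce
  split_ifs with h1
  · change Cyc s m a l at h1
    rcases h1 with ⟨rfl, h1⟩ | ⟨rfl, h1⟩
    · have h2 := hz a ha h1
      rw [ev, dif_pos hx', Finsupp.lapply_apply] at h2
      rw [h2, zero_smul]
      exact S.zero_mem
    · apply Submodule.smul_mem
      have := hS a ha h1
      rw [be_of_good k hx'] at this
      exact this
  · simp

theorem ev_d (hg : IsGentle Q R) (hs : IsSucc Q R s) (n : ℕ) (hn : Fintype.card Q.A < n + 1)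
    {a : Q.A} (ha : Per Q R a) (h : (s ^ (n + 1)) a = a) (z : Coch k Q R (n + 1)) :
    ev k R s (n + 2) a [a] (dLin k Q R (n + 1) z) =
      ev k R s (n + 1) a [] z - (-1) ^ (n + 1) * ev k R s (n + 1) (s a) [] z := by
  classical
  have : ev k R s (n + 2) a [a] ∘ₗ dLin k Q R (n + 1) =
      ev k R s (n + 1) a [] - ((-1 : k) ^ (n + 1)) • ev k R s (n + 1) (s a) [] := by
    apply lin_ext k hg hs hn
    intro a' l' ha' h'
    have h2 : (s ^ (n + 1)) (s a) = s a := by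
      rw [← Equiv.Perm.mul_apply, ← pow_succ, pow_succ', Equiv.Perm.mul_apply, h]
    have hy := good_single hg hs ha n h
    simp only [LinearMap.comp_apply, LinearMap.sub_apply, LinearMap.smul_apply]
    rw [d_be k hg hs ha' n l' h', ev_be k (good_nil hg hs ha n h),
      ev_be k (good_nil hg hs (per_s hg hs ha) n h2), map_sub, map_smul]
    by_cases hl : l' = []
    · subst hl
      simp only [List.getLast?_nil, List.head?_nil, reduceCtorEq, if_false, List.nil_append,
        and_true]
      rw [ev_be k hy, ev_be k hy]
      have e1 : (a' = a ∧ [(s ^ (n + 1)) a'] = [a]) ↔ a' = a := by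
        constructor
        · exact fun h => h.1
        · rintro rfl
          exact ⟨rfl, by rw [h]⟩
      have e2 : (s.symm a' = a ∧ [s.symm a'] = [a]) ↔ a' = s a := by
        rw [← Equiv.symm_apply_eq]
        simp
      rw [if_congr e1 rfl rfl, if_congr e2 rfl rfl]
    · have e1 : ∀ c, l' ++ [c] ≠ [a] := by
        intro c hc
        have := congrArg List.length hc
        simp at this
        exact hl this
      have e2 : ∀ c, c :: l' ≠ [a] := by
        intro c hc
        have := congrArg List.length hc
        simp at this
        exact hl this
      have e3 : ∀ b l (c : Prop) [Decidable c], ev k R s (n + 2) a [a] (if c then 0 else be k R s (n + 2) b l) =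
          if c then 0 else if b = a ∧ l = [a] then 1 else 0 := by
        intro b l c _
        split_ifs <;> simp_all [ev_be k hy]
      rw [e3, e3]
      simp [e1, e2, hl]
  exact congrArg (fun f => f z) this

theorem d_nil (hg : IsGentle Q R) (hs : IsSucc Q R s) (n : ℕ)
    {a : Q.A} (ha : Per Q R a) (h : (s ^ (n + 1)) a = a) :
    dLin k Q R (n + 1) (be k R s (n + 1) a []) =
      be k R s (n + 2) a [a] - ((-1 : k) ^ (n + 1)) • be k R s (n + 2) (s.symm a) [s.symm a] := by
  classical
  rw [d_be k hg hs ha n [] (good_nil hg hs ha n h)]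
  simp [h]

theorem d_single (hg : IsGentle Q R) (hs : IsSucc Q R s) (n : ℕ)
    {a : Q.A} (ha : Per Q R a) (h : (s ^ (n + 1)) a = a) :
    dLin k Q R (n + 2) (be k R s (n + 2) a [a]) = 0 := by
  classical
  rw [d_be k hg hs ha (n + 1) [a] (good_single hg hs ha n h)]
  simp [h]

end

/-! ### The dimension bound -/

theorem exists_lifts (k : Type) [Field k] {V : Type} [AddCommGroup V] [Module k V]
    {ι : Type} [Fintype ι] (K : Submodule k V) (f : V →ₗ[k] (ι → k)) :
    ∃ G : Finset V, G.card ≤ Fintype.card ι ∧ (↑G : Set V) ⊆ K ∧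
      ∀ z ∈ K, ∃ g ∈ Submodule.span k (↑G : Set V), f (z - g) = 0 := by
  classical
  let W := K.map f
  let b := Module.finBasis k W
  have hb : ∀ i, ∃ v, v ∈ K ∧ f v = (b i : ι → k) := fun i => by
    obtain ⟨v, hv, h⟩ := Submodule.mem_map.1 (b i).2
    exact ⟨v, hv, h⟩
  choose v hv hfv using hb
  refine ⟨Finset.univ.image v, ?_, ?_, ?_⟩
  · refine Finset.card_image_le.trans ?_
    rw [Finset.card_univ, Fintype.card_fin]
    refine (Submodule.finrank_le W).trans ?_
    simp
  · intro x hx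
    simp at hx
    obtain ⟨i, rfl⟩ := hx
    exact hv i
  · intro z hz
    let y : W := ⟨f z, Submodule.mem_map_of_mem hz⟩
    refine ⟨∑ i, b.repr y i • v i, ?_, ?_⟩
    · apply Submodule.sum_mem
      intro i _
      apply Submodule.smul_mem
      apply Submodule.subset_span
      simp
    · rw [map_sub, map_sum, sub_eq_zero]
      have := congrArg W.subtype (b.sum_repr y)
      rw [map_sum] at this
      simp only [map_smul, hfv]
      exact this.symm

section
variable {Q : Quiv} {R : Set (Q.A × Q.A)} {s : Equiv.Perm Q.A}
variable (k : Type) [Field k]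

theorem pow_fix {s : Equiv.Perm Q.A} {a : Q.A} {n : ℕ} (i : ℕ) :
    (s ^ n) ((s ^ i) a) = (s ^ i) a ↔ (s ^ n) a = a := by
  rw [← Equiv.Perm.mul_apply, ← pow_add, add_comm, pow_add, Equiv.Perm.mul_apply]
  exact (s ^ i).injective.eq_iff

theorem single_mem (hg : IsGentle Q R) (hs : IsSucc Q R s) (m : ℕ)
    (S : Submodule k (Coch k Q R (m + 2))) (hS : LinearMap.range (dLin k Q R (m + 1)) ≤ S)
    {a : Q.A} (ha : Per Q R a) (h : (s ^ (m + 1)) a = a) (h1 : be k R s (m + 2) a [a] ∈ S)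
    (i : ℕ) : be k R s (m + 2) ((s ^ i) a) [(s ^ i) a] ∈ S := by
  induction i with
  | zero => simpa using h1
  | succ i ih =>
    have h2 := d_nil k hg hs m (per_pow hg hs ha (i + 1)) ((pow_fix (i + 1)).2 h)
    have h3 : s.symm ((s ^ (i + 1)) a) = (s ^ i) a := by
      rw [pow_succ', Equiv.Perm.mul_apply, Equiv.symm_apply_apply]
    rw [h3, eq_sub_iff_add_eq] at h2
    rw [← h2]
    exact S.add_mem (hS ⟨_, rfl⟩) (S.smul_mem _ ih)

theorem ev_zero (hg : IsGentle Q R) (hs : IsSucc Q R s) (n : ℕ) (hn : Fintype.card Q.A < n + 1)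
    (z : Coch k Q R (n + 1)) (hz : dLin k Q R (n + 1) z = 0)
    {a : Q.A} (ha : Per Q R a) (h : (s ^ (n + 1)) a = a)
    (h1 : ev k R s (n + 1) a [] z = 0) (i : ℕ) : ev k R s (n + 1) ((s ^ i) a) [] z = 0 := by
  induction i with
  | zero => simpa using h1
  | succ i ih =>
    have h2 := ev_d k hg hs n hn (per_pow hg hs ha i) ((pow_fix i).2 h) z
    rw [hz, map_zero, ih, zero_sub, eq_comm, neg_eq_zero, mul_eq_zero] at h2
    rw [pow_succ', Equiv.Perm.mul_apply]
    rcases h2 with h2 | h2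
    · exact absurd h2 (pow_ne_zero _ (by simp))
    · exact h2

theorem dim_le (hg : IsGentle Q R) (hs : IsSucc Q R s) (m : ℕ) (hn : Fintype.card Q.A < m + 2)
    {ι : Type} [Fintype ι] (rep : ι → Q.A) (hr1 : ∀ c, Per Q R (rep c))
    (hr2 : ∀ a, Per Q R a → ∃ c i, a = (s ^ i) (rep c)) :
    CohomDimLe k Q R (m + 2) (2 * Fintype.card ι) := by
  classical
  let f : Coch k Q R (m + 2) →ₗ[k] (ι → k) :=
    LinearMap.pi (fun c => ev k R s (m + 2) (rep c) [])
  obtain ⟨G, hG1, hG2, hG3⟩ := exists_lifts k (cocSp k Q R (m + 2)) f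
  let y : ι → Coch k Q R (m + 2) := fun c =>
    if (s ^ (m + 1)) (rep c) = rep c then be k R s (m + 2) (rep c) [rep c] else 0
  have hy : ∀ c, y c ∈ cocSp k Q R (m + 2) := by
    intro c
    simp only [y]
    split_ifs with h
    · exact d_single k hg hs m (hr1 c) h
    · exact Submodule.zero_mem _
  refine ⟨G ∪ Finset.univ.image y, ?_, ?_, ?_⟩
  · refine (Finset.card_union_le _ _).trans ?_
    have : (Finset.univ.image y).card ≤ Fintype.card ι := Finset.card_image_le
    omega
  · intro x hx
    simp at hx
    rcases hx with hx | ⟨c, rfl⟩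
    · exact hG2 hx
    · exact hy c
  · intro z hz
    set S := cobSp k Q R (m + 2) ⊔ Submodule.span k (↑(G ∪ Finset.univ.image y) : Set _) with hS
    have hcob : LinearMap.range (dLin k Q R (m + 1)) ≤ S := le_sup_left
    obtain ⟨g, hg1, hg2⟩ := hG3 z hz
    have hgS : g ∈ S := by
      apply (le_sup_right : _ ≤ S)
      refine Submodule.span_mono ?_ hg1
      simp
    have hgc : g ∈ cocSp k Q R (m + 2) := (Submodule.span_le.2 hG2) hg1
    have hu : dLin k Q R (m + 2) (z - g) = 0 := Submodule.sub_mem (cocSp k Q R (m + 2)) hz hgc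
    have hyS : ∀ c, y c ∈ S := by
      intro c
      apply (le_sup_right : _ ≤ S)
      apply Submodule.subset_span
      simp
    have h1 : z - g ∈ S := by
      rw [decomp k hg hs m hn (z - g), hu, map_zero, add_zero]
      refine S.add_mem (hcob ⟨_, rfl⟩) (pr_mem k hg hs m hn _ ?_ S ?_)
      · intro a ha h
        obtain ⟨c, i, rfl⟩ := hr2 a ha
        refine ev_zero k hg hs (m + 1) hn _ hu (hr1 c) ((pow_fix i).1 h) ?_ i
        exact congrFun hg2 c
      · intro a ha h
        obtain ⟨c, i, rfl⟩ := hr2 a ha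
        refine single_mem k hg hs m S hcob (hr1 c) ((pow_fix i).1 h) ?_ i
        have := hyS c
        simp only [y] at this
        rwa [if_pos ((pow_fix i).1 h)] at this
    have := S.add_mem h1 hgS
    rwa [sub_add_cancel] at this

/-- If there are no periodic arrows or no arrows at all, high degrees vanish. -/
theorem exists_per (hg : IsGentle Q R) (hs : IsSucc Q R s) (m : ℕ) (hn : Fintype.card Q.A < m)
    (h : ¬ CohomIsZero k Q R m) : ∃ a, Per Q R a := by
  by_contra hno
  apply h
  have : IsEmpty (GB Q R m) := ⟨fun x => by
    obtain ⟨a, l, ha, -⟩ := exists_raw hg hs hn x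
    exact hno ⟨a, ha⟩⟩
  intro z _
  rw [Subsingleton.elim z 0]
  exact Submodule.zero_mem _

theorem not_zero (hg : IsGentle Q R) (hs : IsSucc Q R s) (n : ℕ) (hn : Fintype.card Q.A < n + 1)
    (he : Even (n + 2)) (hp : s ^ (n + 2) = 1) {a : Q.A} (ha : Per Q R a) :
    ¬ CohomIsZero k Q R (n + 2) := by
  classical
  intro h0
  have hfix : ∀ b, (s ^ (n + 2)) b = b := fun b => by rw [hp]; rfl
  let g : Q.A → Coch k Q R (n + 3) := fun b => if Per Q R b then be k R s (n + 3) b [b] else 0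
  let X : Coch k Q R (n + 2) := ∑ b : Q.A, if Per Q R b then be k R s (n + 2) b [] else 0
  have hX : X ∈ cocSp k Q R (n + 2) := by
    have : dLin k Q R (n + 2) X = ∑ b : Q.A, (g b - g (s.symm b)) := by
      simp only [X, map_sum]
      refine Finset.sum_congr rfl fun b _ => ?_
      simp only [g]
      by_cases hb : Per Q R b
      · rw [if_pos hb, if_pos hb, if_pos (per_symm hg hs hb), d_nil k hg hs (n + 1) hb (hfix b),
          he.neg_one_pow, one_smul]
      · have : ¬ Per Q R (s.symm b) := fun h => hb (by simpa using per_s hg hs h)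
        rw [if_neg hb, if_neg hb, if_neg this]
        simp
    change dLin k Q R (n + 2) X = 0
    rw [this, Finset.sum_sub_distrib, Equiv.sum_comp s.symm g, sub_self]
  obtain ⟨w, hw⟩ := h0 hX
  have hgood := good_nil hg hs ha (n + 1) (hfix a)
  have h1 : ev k R s (n + 2) a [] X = 1 := by
    simp only [X, map_sum]
    rw [Finset.sum_eq_single a]
    · rw [if_pos ha, ev_be k hgood]
      simp
    · intro b _ hb
      split_ifs
      · rw [ev_be k hgood, if_neg (fun h => hb h.1)]
      · simp
    · simp
  have h2 : ev k R s (n + 2) a [] ∘ₗ dLin k Q R (n + 1) = 0 := by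
    apply lin_ext k hg hs hn
    intro b l hb hbl
    simp only [LinearMap.comp_apply, LinearMap.zero_apply]
    have e3 : ∀ b l (c : Prop) [Decidable c],
        ev k R s (n + 2) a [] (if c then 0 else be k R s (n + 2) b l) =
          if c then 0 else if b = a ∧ l = [] then 1 else 0 := by
      intro b l c _
      split_ifs <;> simp_all [ev_be k hgood]
    rw [d_be k hg hs hb n l hbl, map_sub, map_smul, e3, e3]
    simp
  have h3 := congrArg (fun f => f w) h2
  simp only [LinearMap.comp_apply, LinearMap.zero_apply] at h3
  rw [hw, h1] at h3
  exact one_ne_zero h3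

/-! ### Primitive complete cycles -/

theorem powL_wl {s : Equiv.Perm Q.A} {a : Q.A} {r : ℕ} (h : (s ^ r) a = a) (q : ℕ) :
    powL (wl s a r) q = wl s a (r * q) := by
  induction q with
  | zero => rfl
  | succ q ih => rw [powL, ih, mul_add, mul_one, add_comm, wl_add, h]

theorem wl_cycle (hg : IsGentle Q R) (hs : IsSucc Q R s) {a : Q.A} (ha : Per Q R a) {r : ℕ}
    (hr : 0 < r) (h : (s ^ r) a = a) : IsCycle Q (Q.src a, wl s a r) := by
  obtain ⟨n, rfl⟩ : ∃ n, r = n + 1 := ⟨r - 1, by omega⟩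
  refine ⟨⟨?_, by simp [wl]⟩, by simp [wl], ?_⟩
  · exact List.IsChain.imp (fun x y h => hg.relComposable (x, y) h) (wl_chain hg hs ha _)
  · simp only [psrc, ptgt, wl_getLast?]
    have := hg.relComposable _ (rel_pow hg hs ha n)
    simp only [h] at this
    simp [this]

theorem wl_complete (hg : IsGentle Q R) (hs : IsSucc Q R s) {a : Q.A} (ha : Per Q R a) {r : ℕ}
    (hr : 0 < r) (h : (s ^ r) a = a) : Complete Q R (Q.src a, wl s a r) := by
  refine ⟨wl_cycle hg hs ha hr h, ?_⟩
  have h2 : (s ^ (r * 2)) a = a := by rw [mul_two, pow_add, Equiv.Perm.mul_apply, h, h]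
  have : powP Q (Q.src a, wl s a r) 2 = (Q.src a, wl s a (r * 2)) := by
    simp only [powP, powL_wl h]
  rw [this]
  exact ⟨(wl_cycle hg hs ha (by omega) h2).1, wl_chain hg hs ha _⟩

theorem complete_eq (hg : IsGentle Q R) (hs : IsSucc Q R s) (p : PathDat Q)
    (hp : Complete Q R p) : ∃ a r, Per Q R a ∧ 0 < r ∧ (s ^ r) a = a ∧ p = (Q.src a, wl s a r) := by
  obtain ⟨v, l⟩ := p
  obtain ⟨⟨⟨-, h1⟩, h2, -⟩, -, h3⟩ := hp
  change List.IsChain _ (l ++ (l ++ [])) at h3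
  rw [List.append_nil] at h3
  cases l with
  | nil => simp at h2
  | cons a t =>
    have h3' := List.isChain_iff_pairwise.1 (List.IsChain.imp
      (S := Relation.TransGen (fun x y => (x, y) ∈ R)) (fun _ _ h => Relation.TransGen.single h) h3)
    have ha : Per Q R a := by
      rw [List.pairwise_append] at h3'
      exact h3'.2.2 a (by simp) a (by simp)
    have h4 := eq_wl hg hs (t ++ (a :: t)) a ha h3
    have h5 : (t ++ a :: t).length + 1 = (t.length + 1) + (t.length + 1) := by simp; omega
    rw [h5, wl_add, ← List.cons_append] at h4
    obtain ⟨h6, h7⟩ := List.append_inj h4 (by simp [wl_length])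
    refine ⟨a, t.length + 1, ha, by omega, ?_, ?_⟩
    · rw [wl] at h7
      exact (List.cons.inj h7).1.symm
    · rw [← h6, show Q.src a = v from h1 a (by simp)]

theorem minPer_pos (s : Equiv.Perm Q.A) (a : Q.A) : 0 < Function.minimalPeriod s a := by
  apply Function.IsPeriodicPt.minimalPeriod_pos (n := orderOf s) (orderOf_pos s)
  change s^[orderOf s] a = a
  rw [Equiv.Perm.iterate_eq_pow, pow_orderOf_eq_one]
  rfl

theorem minPer_fix (s : Equiv.Perm Q.A) (a : Q.A) : (s ^ Function.minimalPeriod s a) a = a := by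
  have := Function.isPeriodicPt_minimalPeriod s a
  change s^[_] a = a at this
  rwa [Equiv.Perm.iterate_eq_pow] at this

theorem minPer_dvd (s : Equiv.Perm Q.A) (a : Q.A) {r : ℕ} (h : (s ^ r) a = a) :
    Function.minimalPeriod s a ∣ r := by
  apply Function.IsPeriodicPt.minimalPeriod_dvd
  change s^[_] a = a
  rwa [Equiv.Perm.iterate_eq_pow]

theorem primitive_eq (hg : IsGentle Q R) (hs : IsSucc Q R s) (p : PathDat Q)
    (hp : IsPrimitive Q p) (hc : Complete Q R p) :
    ∃ a, Per Q R a ∧ p = (Q.src a, wl s a (Function.minimalPeriod s a)) := by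
  obtain ⟨a, r, ha, hr, h, rfl⟩ := complete_eq hg hs p hc
  obtain ⟨q, rfl⟩ := minPer_dvd s a h
  refine ⟨a, ha, ?_⟩
  by_cases hq : 2 ≤ q
  · exfalso
    refine hp.2 (Q.src a, wl s a (Function.minimalPeriod s a)) q
      (wl_cycle hg hs ha (minPer_pos s a) (minPer_fix s a)) hq ?_
    simp only [powP, powL_wl (minPer_fix s a)]
  · have : q = 1 := by
      rcases Nat.eq_zero_or_pos q with rfl | h
      · simp at hr
      · omega
    rw [this, mul_one]

theorem powL_length {α : Type} (l : List α) (n : ℕ) : (powL l n).length = n * l.length := by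
  induction n with
  | zero => simp [powL]
  | succ n ih => rw [powL, List.length_append, ih]; ring

theorem wl_primitive (hg : IsGentle Q R) (hs : IsSucc Q R s) {a : Q.A} (ha : Per Q R a) :
    IsPrimitive Q (Q.src a, wl s a (Function.minimalPeriod s a)) := by
  refine ⟨wl_cycle hg hs ha (minPer_pos s a) (minPer_fix s a), ?_⟩
  rintro ⟨v, l⟩ n ⟨-, hl, -⟩ hn h
  simp only [powP, Prod.mk.injEq] at h hl
  obtain ⟨-, h⟩ := h
  have hlen := congrArg List.length h
  rw [wl_length, powL_length] at hlen
  obtain ⟨n, rfl⟩ : ∃ j, n = j + 2 := ⟨n - 2, by omega⟩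
  have hu : 0 < l.length := List.length_pos_iff.2 hl
  obtain ⟨j, hj⟩ : ∃ j, Function.minimalPeriod s a = l.length + (j + 1) :=
    ⟨(n + 1) * l.length - 1, by
      have : 0 < (n + 1) * l.length := by positivity
      have e : (n + 2) * l.length = l.length + (n + 1) * l.length := by ring
      omega⟩
  have hfix : (s ^ l.length) a = a := by
    rw [hj, wl_add, powL] at h
    obtain ⟨h6, h7⟩ := List.append_inj h (by rw [wl_length])
    cases l with
    | nil => exact absurd rfl hl
    | cons b t =>
      rw [List.length_cons, wl] at h6
      rw [wl, powL, List.cons_append] at h7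
      rw [(List.cons.inj h7).1, ← (List.cons.inj h6).1]
  have := Nat.le_of_dvd hu (minPer_dvd s a hfix)
  omega

theorem rotP_mem (p : PathDat Q) (x : Q.A) : x ∈ (rotP Q p).2 ↔ x ∈ p.2 := by
  obtain ⟨v, l⟩ := p
  rcases List.eq_nil_or_concat l with rfl | ⟨l, c, rfl⟩
  · rfl
  · simp [rotP, or_comm]

theorem rotI_mem (i : ℕ) (p : PathDat Q) (x : Q.A) : x ∈ (rotI Q i p).2 ↔ x ∈ p.2 := by
  induction i with
  | zero => rfl
  | succ i ih =>
    rw [rotI, Function.iterate_succ_apply', rotP_mem]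
    exact ih

theorem quot_mem {p q : PathDat Q} (h : Quot.mk (RotEquiv Q) p = Quot.mk (RotEquiv Q) q)
    (x : Q.A) : x ∈ p.2 ↔ x ∈ q.2 := by
  let F : Quot (RotEquiv Q) → Prop := Quot.lift (fun p => x ∈ p.2) (by
    rintro p _ ⟨i, rfl⟩
    exact propext (rotI_mem i p x).symm)
  have : F (Quot.mk _ p) = F (Quot.mk _ q) := by rw [h]
  exact iff_of_eq this

end

/-- Let `(Q, R)` be a finite-dimensional gentle presentation
(`B` finite). (1) The set of rotation classes of primitive complete cycles is
finite, of cardinality `N` say, and `dim HH^m ≤ 2N` whenever `m > |Q₁|`; in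
particular the sequence of dimensions is bounded. (2) If `HH^m ≠ 0` for some
`m > |Q₁|` then `HH^{m'} ≠ 0` for infinitely many `m' > |Q₁|`. -/
theorem bounded_cohomology_dimensions (k : Type) [Field k] (Q : Quiv)
    (R : Set (Q.A × Q.A)) (hg : IsGentle Q R)
    (hfin : {p : PathDat Q | InB Q R p}.Finite) :
    ((Quot.mk (RotEquiv Q) ''
        {p : PathDat Q | IsPrimitive Q p ∧ Complete Q R p}).Finite ∧
      ∀ m : ℕ, Fintype.card Q.A < m →
        CohomDimLe k Q R m
          (2 * (Quot.mk (RotEquiv Q) ''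
              {p : PathDat Q | IsPrimitive Q p ∧ Complete Q R p}).ncard)) ∧
    ((∃ m : ℕ, Fintype.card Q.A < m ∧ ¬CohomIsZero k Q R m) →
      {m : ℕ | Fintype.card Q.A < m ∧ ¬CohomIsZero k Q R m}.Infinite) := by
  classical
  obtain ⟨s, hs⟩ := exists_perm hg
  have hs : IsSucc Q R s := hs
  set T := Quot.mk (RotEquiv Q) '' {p : PathDat Q | IsPrimitive Q p ∧ Complete Q R p} with hT
  have hfinT : T.Finite := by
    apply Set.Finite.image
    refine (Set.finite_range
      (fun a : Q.A => ((Q.src a, wl s a (Function.minimalPeriod s a)) : PathDat Q))).subset ?_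
    rintro p ⟨hp, hc⟩
    obtain ⟨a, -, rfl⟩ := primitive_eq hg hs p hp hc
    exact ⟨a, rfl⟩
  refine ⟨⟨hfinT, ?_⟩, ?_⟩
  · intro m hm
    by_cases hm2 : 2 ≤ m
    · obtain ⟨m, rfl⟩ : ∃ j, m = j + 2 := ⟨m - 2, by omega⟩
      have : Fintype T := hfinT.fintype
      have hrep : ∀ c : T, ∃ a, Per Q R a ∧
          Quot.mk (RotEquiv Q) (Q.src a, wl s a (Function.minimalPeriod s a)) = c.val := by
        rintro ⟨c, p, ⟨hp, hc⟩, rfl⟩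
        obtain ⟨a, ha, rfl⟩ := primitive_eq hg hs p hp hc
        exact ⟨a, ha, rfl⟩
      choose rep hr1 hr2 using hrep
      have hd : CohomDimLe k Q R (m + 2) (2 * Nat.card T) := by
        rw [Nat.card_eq_fintype_card]
        refine dim_le k hg hs m hm rep hr1 ?_
        intro a ha
        refine ⟨⟨Quot.mk _ (Q.src a, wl s a (Function.minimalPeriod s a)), _,
          ⟨wl_primitive hg hs ha, wl_complete hg hs ha (minPer_pos s a) (minPer_fix s a)⟩, rfl⟩, ?_⟩
        have hq := (quot_mem (hr2 ⟨Quot.mk _ (Q.src a, wl s a (Function.minimalPeriod s a)), _,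
          ⟨wl_primitive hg hs ha, wl_complete hg hs ha (minPer_pos s a) (minPer_fix s a)⟩, rfl⟩) a).2
        refine mem_wl s _ _ (hq ?_)
        obtain ⟨j, hj⟩ : ∃ j, Function.minimalPeriod s a = j + 1 :=
          ⟨Function.minimalPeriod s a - 1, by have := minPer_pos s a; omega⟩
        rw [hj, wl]
        simp
      rwa [Nat.card_coe_set_eq] at hd
    · refine ⟨∅, by simp, by simp, ?_⟩
      have : IsEmpty Q.A := Fintype.card_eq_zero_iff.1 (by omega)
      have : IsEmpty (GB Q R m) := ⟨fun x => by
        obtain ⟨a, -⟩ := exists_raw hg hs hm x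
        exact isEmptyElim a⟩
      intro z _
      rw [Subsingleton.elim z 0]
      exact Submodule.zero_mem _
  · rintro ⟨m, hm, h0⟩
    obtain ⟨a, ha⟩ := exists_per k hg hs m hm h0
    apply Set.infinite_of_not_bddAbove
    rintro ⟨N, hN⟩
    have ho := orderOf_pos s
    obtain ⟨n, hn⟩ : ∃ n, 2 * (N + Fintype.card Q.A + 2) * orderOf s = n + 2 :=
      ⟨2 * (N + Fintype.card Q.A + 2) * orderOf s - 2, by
        have : 2 * (N + Fintype.card Q.A + 2) * 1 ≤ 2 * (N + Fintype.card Q.A + 2) * orderOf s :=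
          Nat.mul_le_mul_left _ ho
        omega⟩
    have hle : 2 * (N + Fintype.card Q.A + 2) ≤ n + 2 := by
      have : 2 * (N + Fintype.card Q.A + 2) * 1 ≤ 2 * (N + Fintype.card Q.A + 2) * orderOf s :=
        Nat.mul_le_mul_left _ ho
      omega
    have hmem : n + 2 ∈ {m : ℕ | Fintype.card Q.A < m ∧ ¬CohomIsZero k Q R m} := by
      refine ⟨by omega, not_zero k hg hs n (by omega) ?_ ?_ ha⟩
      · rw [← hn, mul_assoc]
        exact even_two_mul _
      · rw [← hn, mul_comm, pow_mul, pow_orderOf_eq_one, one_pow]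
    have := hN hmem
    omega

end GentleTT
end

section
/- Let (Q,R) be a quadratic monomial presentation and write H_m for the degree-m homology of the complex k(B⊙Γ). (1) H_0 is freely spanned by the classes of: the pairs (e,e), one for each vertex e of Q; the pairs (C̄, s(C̄)), one for each cocomplete circuit C; and the pairs (a, s(a)), one for each loop a with a² ∈ R. (2) H_1 is freely spanned by the classes of: the sums ĥ(C̄) = Σ_{i=0}^{r−1} (r1(rot^i(C̄)), r2(rot^i(C̄))), one for each cocomplete circuit C of period r; the pairs (s(a), a) with a a loop with a² ∈ R; and the pairs (l1(C̄), l2(C̄)), one for each complete circuit C of length 2 and period r with (−1)^r = 1 in k. (3) For m ≥ 2, H_m is freely spanned by the classes of: the sums ĥ(C̄) = Σ_{i=0}^{r−1} (−1)^{(m+1)i} (s(rot^i(C̄)), rot^i(C̄)), one for each complete circuit C of length m and period r with (−1)^{(m+1)r} = 1 in k; and the pairs (l1(C̄), l2(C̄)), one for each complete circuit C of length m+1 and period r with (−1)^{mr} = 1 in k. (The paper identifies this homology with the Hochschild homology HH_*(kQ/⟨R⟩).) -/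
/-!
Common framework: quivers, paths (as a start vertex together with a list of
composable arrows, listed in order of traversal, so that the paper's path
`c_m ⋯ c_1` corresponds to the list `[c_1, …, c_m]`), gentle and quadratic
monomial presentations, the cochain complex `k(Γ ∥ B)` and the chain complex
`k(B ⊙ Γ)` of the paper.
-/

namespace GentleTT

/-- The generating set of Theorem `thm:basishomology` in each degree `m`, for a
choice `Rc` (resp. `Rg`) of one cycle in each cocomplete (resp. complete)
circuit. -/
def GenHom (k : Type) [Field k] (Q : Quiv) (R : Set (Q.A × Q.A))
    (Rc Rg : Set (PathDat Q)) (m : ℕ) : Set (Chn k Q R m) :=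
  {x | m = 0 ∧ ∃ e : Q.V, x = bw k Q R m ((e, []), (e, []))} ∪
  {x | m = 0 ∧ ∃ c ∈ Rc, x = bw k Q R m (c, (c.1, []))} ∪
  {x | m = 0 ∧ ∃ a : Q.A, Q.src a = Q.tgt a ∧ (a, a) ∈ R ∧
       x = bw k Q R m ((Q.src a, [a]), (Q.src a, []))} ∪
  {x | m = 1 ∧ ∃ c ∈ Rc, x = hCycR k Q R m c} ∪
  {x | m = 1 ∧ ∃ a : Q.A, Q.src a = Q.tgt a ∧ (a, a) ∈ R ∧
       x = bw k Q R m ((Q.src a, []), (Q.src a, [a]))} ∪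
  {x | m = 1 ∧ ∃ c ∈ Rg, plen Q c = 2 ∧ (-1 : k) ^ (periodP Q c) = 1 ∧
       x = bw k Q R m (l1P Q c, l2P Q c)} ∪
  {x | 2 ≤ m ∧ ∃ c ∈ Rg, plen Q c = m ∧ (-1 : k) ^ ((m + 1) * periodP Q c) = 1 ∧
       x = hCycM k Q R m c} ∪
  {x | 2 ≤ m ∧ ∃ c ∈ Rg, plen Q c = m + 1 ∧ (-1 : k) ^ (m * periodP Q c) = 1 ∧
       x = bw k Q R m (l1P Q c, l2P Q c)}

section P1sec

/-- `S` holds at the cyclic position `i` of the word `w`. -/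
def Pz {α : Type} (S : α → α → Prop) (w : List α) (i : ℕ) : Prop :=
  ∀ a b, w[i % w.length]? = some a → w[(i + 1) % w.length]? = some b → S a b

/-- `S` holds at all cyclic positions. -/
def CycS {α : Type} (S : α → α → Prop) (w : List α) : Prop :=
  w.IsChain S ∧ ∀ a ∈ w.getLast?, ∀ b ∈ w.head?, S a b

theorem pz_of_lt {α : Type} {S : α → α → Prop} {w : List α} {i : ℕ} (h : i + 1 < w.length) :
    Pz S w i ↔ S w[i] w[i+1] := by
  unfold Pz
  rw [Nat.mod_eq_of_lt h, Nat.mod_eq_of_lt (by omega : i < w.length)]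
  simp only [List.getElem?_eq_getElem h, List.getElem?_eq_getElem (by omega : i < w.length)]
  constructor
  · intro h; exact h _ _ rfl rfl
  · rintro h a b h1 h2
    simp at h1 h2; subst h1; subst h2; exact h

theorem pz_mod {α : Type} {S : α → α → Prop} {w : List α} {i : ℕ} :
    Pz S w (i % w.length) ↔ Pz S w i := by
  unfold Pz
  simp

theorem pz_add {α : Type} {S : α → α → Prop} {w : List α} {i : ℕ} :
    Pz S w (i + w.length) ↔ Pz S w i := by
  rw [← pz_mod, Nat.add_mod_right, pz_mod]

theorem pz_not {α : Type} {S : α → α → Prop} {w : List α} (hw : w ≠ []) {i : ℕ} :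
    Pz (fun a b => ¬ S a b) w i ↔ ¬ Pz S w i := by
  have hn : 0 < w.length := List.length_pos_iff.mpr hw
  unfold Pz
  have h1 := Nat.mod_lt i hn
  have h2 := Nat.mod_lt (i+1) hn
  simp only [List.getElem?_eq_getElem h1, List.getElem?_eq_getElem h2]
  simp

theorem pz_rot {α : Type} {S : α → α → Prop} {w : List α} {i : ℕ} :
    Pz S (w.rotate 1) i ↔ Pz S w (i + 1) := by
  rcases eq_or_ne w [] with rfl | hw
  · simp [Pz]
  have hn : 0 < w.length := List.length_pos_iff.mpr hw
  unfold Pz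
  rw [List.length_rotate, List.getElem?_rotate (Nat.mod_lt _ hn),
    List.getElem?_rotate (Nat.mod_lt _ hn)]
  simp

theorem cycS_iff {α : Type} {S : α → α → Prop} {w : List α} (hw : w ≠ []) :
    CycS S w ↔ ∀ i, Pz S w i := by
  have hn : 0 < w.length := List.length_pos_iff.mpr hw
  have hl : (∀ a ∈ w.getLast?, ∀ b ∈ w.head?, S a b) ↔ Pz S w (w.length - 1) := by
    unfold Pz
    rw [Nat.sub_add_cancel hn, Nat.mod_self, Nat.mod_eq_of_lt (by omega), List.getLast?_eq_getElem?,
      List.head?_eq_getElem?]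
    simp only [Option.mem_def]
    exact ⟨fun h a b ha hb => h a ha b hb, fun h a ha b hb => h a b ha hb⟩
  unfold CycS
  rw [hl, List.isChain_iff_getElem]
  constructor
  · rintro ⟨h1, h2⟩ i
    rw [← pz_mod]
    have := Nat.mod_lt i hn
    by_cases h : i % w.length + 1 < w.length
    · rw [pz_of_lt h]; exact h1 _ h
    · have : i % w.length = w.length - 1 := by omega
      rw [this]; exact h2
  · intro h
    exact ⟨fun i hi => (pz_of_lt hi).1 (h i), h _⟩

theorem take_iff {α : Type} {S : α → α → Prop} {w : List α} {m : ℕ} (hm : m ≤ w.length) :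
    (w.take m).IsChain S ↔ ∀ i, i + 1 < m → Pz S w i := by
  rw [List.isChain_iff_getElem]
  constructor
  · intro h i hi
    rw [pz_of_lt (by omega)]
    have := h i (by simp; omega)
    simpa using this
  · intro h i hi
    simp at hi
    have := (pz_of_lt (by omega)).1 (h i (by omega))
    simpa using this

theorem drop_iff {α : Type} {S : α → α → Prop} {w : List α} {m : ℕ} (hm : m ≤ w.length) :
    (w.drop m).IsChain S ↔ ∀ i, m ≤ i → i + 1 < w.length → Pz S w i := by
  rw [List.isChain_iff_getElem]
  constructor
  · intro h i hmi hi
    rw [pz_of_lt (by omega)]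
    have := h (i - m) (by simp; omega)
    simp only [List.getElem_drop] at this
    have e1 : m + (i - m) = i := by omega
    have e2 : m + (i - m + 1) = i + 1 := by omega
    simpa [e1, e2] using this
  · intro h i hi
    simp at hi
    have := (pz_of_lt (by omega)).1 (h (m + i) (by omega) (by omega))
    simpa [Nat.add_assoc] using this

theorem cycS_rot {α : Type} {S : α → α → Prop} {w : List α} (hw : w ≠ []) (h : CycS S w) :
    CycS S (w.rotate 1) := by
  rw [cycS_iff (by simpa using hw)]
  rw [cycS_iff hw] at h
  intro i
  rw [pz_rot]; exact h _

section
variable (Q : Quiv) (R : Set (Q.A × Q.A))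

/-- composability -/
def cmp (a b : Q.A) : Prop := Q.tgt a = Q.src b
/-- being a relation -/
def rl (a b : Q.A) : Prop := (a, b) ∈ R

/-- The word `w` split at `m` is a basis element of degree `m`. -/
def VV (m : ℕ) (w : List Q.A) : Prop :=
  w ≠ [] ∧ m ≤ w.length ∧ CycS (cmp Q) w ∧ (w.take m).IsChain (rl Q R) ∧
    (w.drop m).IsChain (fun a b => ¬ rl Q R a b)

theorem VV_iff {m : ℕ} {w : List Q.A} : VV Q R m w ↔ w ≠ [] ∧ m ≤ w.length ∧ CycS (cmp Q) w ∧
    (∀ i, i + 1 < m → Pz (rl Q R) w i) ∧ (∀ i, m ≤ i → i + 1 < w.length → ¬ Pz (rl Q R) w i) := by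
  unfold VV
  constructor
  · rintro ⟨h1, h2, h3, h4, h5⟩
    rw [take_iff h2] at h4
    rw [drop_iff h2] at h5
    exact ⟨h1, h2, h3, h4, fun i a b => (pz_not h1).1 (h5 i a b)⟩
  · rintro ⟨h1, h2, h3, h4, h5⟩
    refine ⟨h1, h2, h3, (take_iff h2).2 h4, (drop_iff h2).2 fun i a b => (pz_not h1).2 (h5 i a b)⟩

/-- exactly one of the neighbouring splittings is valid -/
theorem VV_one {m : ℕ} {w : List Q.A} (h : VV Q R m w) :
    VV Q R (m + 1) w ↔ ¬ (1 ≤ m ∧ VV Q R (m - 1) w) := by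
  simp only [VV_iff] at h ⊢
  obtain ⟨h1, h2, h3, h4, h5⟩ := h
  have hn : 0 < w.length := List.length_pos_iff.mpr h1
  simp only [h1, h3, true_and, ne_eq, not_false_eq_true]
  constructor
  · rintro ⟨a1, a2, a3⟩ ⟨b1, b2, b3, b4⟩
    exact b4 (m - 1) le_rfl (by omega) (a2 (m-1) (by omega))
  · intro h
    have hmn : m + 1 ≤ w.length := by
      by_contra hc
      exact h ⟨by omega, by omega, fun i hi => h4 i (by omega), fun i _ _ => by omega⟩
    refine ⟨hmn, fun i hi => ?_, fun i _ _ => h5 i (by omega) (by omega)⟩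
    by_contra hp
    apply h
    refine ⟨by omega, by omega, fun i hi => h4 i (by omega), fun j hj _ => ?_⟩
    by_cases hji : j = m - 1
    · have : i = m - 1 := by
        by_contra hne
        exact hp (h4 i (by omega))
      rw [hji, ← this]; exact hp
    · exact h5 j (by omega) (by omega)

/-- a word having relations as well as non-relations -/
def Mix (w : List Q.A) : Prop := (∃ i, Pz (rl Q R) w i) ∧ ∃ i, ¬ Pz (rl Q R) w i

theorem mix_lt {w : List Q.A} (hw : w ≠ []) (h : Mix Q R w) : 
    (∃ i < w.length, Pz (rl Q R) w i) ∧ ∃ i < w.length, ¬ Pz (rl Q R) w i := by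
  have hn : 0 < w.length := List.length_pos_iff.mpr hw
  obtain ⟨⟨i, hi⟩, j, hj⟩ := h
  exact ⟨⟨i % w.length, Nat.mod_lt _ hn, pz_mod.2 hi⟩, ⟨j % w.length, Nat.mod_lt _ hn, fun h => hj (pz_mod.1 h)⟩⟩

theorem VV_two {m : ℕ} {w : List Q.A} (h : VV Q R m w) (h' : VV Q R m (w.rotate 1)) 
    (hm : Mix Q R w) :
    VV Q R (m + 1) w ↔ (1 ≤ m ∧ VV Q R (m - 1) (w.rotate 1)) := by
  have hc := h'.2.2.1
  simp only [VV_iff] at h h' ⊢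
  obtain ⟨h1, h2, h3, h4, h5⟩ := h
  obtain ⟨h1', h2', h3', h4', h5'⟩ := h'
  obtain ⟨⟨a, ha, pa⟩, b, hb, pb⟩ := mix_lt Q R h1 hm
  have hn : 0 < w.length := List.length_pos_iff.mpr h1
  simp only [h1, h1', h3, h3', true_and, ne_eq, not_false_eq_true, List.length_rotate, pz_rot] at *
  have hm1 : 1 ≤ m := by
    by_contra hm0
    have hm0 : m = 0 := by omega
    subst hm0
    rcases Nat.eq_zero_or_pos a with rfl | ha0
    · rcases Nat.lt_or_ge 1 w.length with hl | hl
      · exact h5 0 le_rfl (by omega) pa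
      · have : b = 0 := by omega
        subst this; exact pb pa
    · obtain ⟨a, rfl⟩ := Nat.exists_eq_add_of_le' ha0
      exact h5' a (by omega) (by omega) pa
  have hmn : m < w.length := by
    by_contra hm0
    have hm0 : m = w.length := by omega
    rcases Nat.eq_zero_or_pos b with rfl | hb0
    · rcases Nat.lt_or_ge 1 w.length with hl | hl
      · exact pb (h4 0 (by omega))
      · have : a = 0 := by omega
        subst this; exact pb pa
    · obtain ⟨b, rfl⟩ := Nat.exists_eq_add_of_le' hb0
      exact pb (h4' b (by omega))
  constructor
  · rintro ⟨a1, a2, a3⟩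
    refine ⟨hm1, by omega, fun i hi => h4' i (by omega), fun i hi hi2 hp => ?_⟩
    by_cases hb : b = m
    · subst hb
      by_cases hi3 : i + 1 = b
      · rw [hi3] at hp; exact pb hp
      · exact h5' i (by omega) (by omega) hp
    · rcases Nat.lt_or_ge b m with hbm | hbm
      · exact pb (a2 b (by omega))
      · by_cases hi3 : i + 1 = m
        · rw [hi3] at hp; exact h5 m le_rfl (by omega) hp
        · exact h5' i (by omega) (by omega) hp
  · rintro ⟨_, a1, a2, a3⟩
    refine ⟨hmn, fun i hi => ?_, fun i hi hi2 => h5 i (by omega) hi2⟩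
    have key : ∀ j, m ≤ j → j < w.length → ¬ Pz (rl Q R) w j := by
      intro j hj hj2 hp
      obtain ⟨j, rfl⟩ := Nat.exists_eq_add_of_le' (hm1.trans hj)
      exact a3 j (by omega) (by omega) hp
    have ham : a < m := by
      by_contra hh
      exact key a (by omega) ha pa
    by_cases hia : i = a
    · rw [hia]; exact pa
    · rcases Nat.eq_zero_or_pos i with rfl | hi0
      · exact h4 0 (by omega)
      · obtain ⟨i, rfl⟩ := Nat.exists_eq_add_of_le' hi0
        exact h4' i (by omega)

theorem VV_co {m : ℕ} {w : List Q.A} (hw : w ≠ []) (hc : CycS (cmp Q) w)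
    (h : ∀ i, ¬ Pz (rl Q R) w i) : VV Q R m w ↔ m = 0 ∨ m = 1 := by
  rw [VV_iff]
  have hn : 0 < w.length := List.length_pos_iff.mpr hw
  constructor
  · rintro ⟨_, _, _, h4, _⟩
    by_contra hm
    exact h 0 (h4 0 (by omega))
  · intro hm
    exact ⟨hw, by omega, hc, fun i hi => by omega, fun i _ _ => h i⟩

theorem VV_com {m : ℕ} {w : List Q.A} (hw : w ≠ []) (hc : CycS (cmp Q) w)
    (h : ∀ i, Pz (rl Q R) w i) : VV Q R m w ↔ m = w.length - 1 ∨ m = w.length - 1 + 1 := by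
  rw [VV_iff]
  have hn : 0 < w.length := List.length_pos_iff.mpr hw
  constructor
  · rintro ⟨_, _, _, _, h4⟩
    by_contra hm
    exact h4 m le_rfl (by omega) (h m)
  · intro hm
    exact ⟨hw, by omega, hc, fun i _ => h i, fun i _ _ => by omega⟩
end

end P1sec

section P2sec
section
variable (k : Type) [Field k] (Q : Quiv) (R : Set (Q.A × Q.A))

/-- the pair of paths obtained by splitting the cyclic word `w` at `m` -/
def sp (m : ℕ) (w : List Q.A) (h : w ≠ []) : PathDat Q × PathDat Q :=
  ((Q.src ((w.drop m ++ w.take m).head (by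
    intro h'
    apply h
    rw [List.append_eq_nil_iff] at h'
    rw [← List.take_append_drop m w, h'.1, h'.2]; rfl)), w.drop m), (Q.src (w.head h), w.take m))

/-- basis vector attached to a split word -/
noncomputable def bet (m : ℕ) (w : List Q.A) : Chn k Q R m := by
  classical
  exact if h : w ≠ [] then bw k Q R m (sp Q m w h) else 0

/-- basis vector attached to a vertex -/
noncomputable def Evec (m : ℕ) (e : Q.V) : Chn k Q R m := bw k Q R m ((e, []), (e, []))

theorem sp_eq {m : ℕ} {x : PathDat Q × PathDat Q} (hl : x.2.2.length = m)
    (hne : x.2.2 ++ x.1.2 ≠ []) (h1 : ∀ a ∈ (x.1.2 ++ x.2.2).head?, Q.src a = x.1.1)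
    (h2 : ∀ a ∈ (x.2.2 ++ x.1.2).head?, Q.src a = x.2.1) :
    sp Q m (x.2.2 ++ x.1.2) hne = x := by
  obtain ⟨⟨v, as⟩, ⟨u, gs⟩⟩ := x
  simp only at *
  subst hl
  unfold sp
  have e1 : ∀ (l : List Q.A) (h : l ≠ []), l.head h ∈ l.head? := fun l h => by
    simp [List.head?_eq_some_head h]
  have h2' := h2 _ (e1 _ hne)
  have h1' := h1 _ (e1 (as ++ gs) (by simp at hne ⊢; tauto))
  simp [h2', h1']

theorem bw_eq {m : ℕ} {x : PathDat Q × PathDat Q} (hl : x.2.2.length = m)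
    (hne : x.2.2 ++ x.1.2 ≠ []) (h1 : ∀ a ∈ (x.1.2 ++ x.2.2).head?, Q.src a = x.1.1)
    (h2 : ∀ a ∈ (x.2.2 ++ x.1.2).head?, Q.src a = x.2.1) :
    bw k Q R m x = bet k Q R m (x.2.2 ++ x.1.2) := by
  unfold bet
  rw [dif_pos hne, sp_eq Q hl hne h1 h2]

theorem bg_iff (hq : IsQuadMon Q R) {m : ℕ} {v u : Q.V} {as gs : List Q.A} (hne : gs ++ as ≠ []) :
    BGmem Q R m ((v, as), (u, gs)) ↔ (VV Q R m (gs ++ as) ∧ gs.length = m ∧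
      (∀ a ∈ (as ++ gs).head?, Q.src a = v) ∧ (∀ a ∈ (gs ++ as).head?, Q.src a = u)) := by
  have key : gs.length = m → (VV Q R m (gs ++ as) ↔ CycS (cmp Q) (gs ++ as) ∧ gs.IsChain (rl Q R)
      ∧ as.IsChain (fun a b => ¬ rl Q R a b)) := by
    rintro rfl
    unfold VV
    simp only [List.take_left', List.drop_left']
    simp only [List.length_append, Nat.le_add_right, true_and, and_iff_right hne]
  unfold BGmem InB InG Ok plen AntiPar psrc ptgt
  simp only [List.Chain']
  change (((List.IsChain (cmp Q) as ∧ _) ∧ List.IsChain (fun a b => ¬ rl Q R a b) as) ∧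
    ((List.IsChain (cmp Q) gs ∧ _) ∧ List.IsChain (rl Q R) gs) ∧ _) ↔ _
  by_cases hl : gs.length = m
  swap
  · simp [hl]
  rw [key hl]
  simp only [hl, true_and]
  unfold CycS
  rw [List.isChain_append]
  have hh : ∀ l : List Q.A, l = [] ∨ ∃ a b, l.head? = some a ∧ l.getLast? = some b ∧ l ≠ [] := by
    intro l
    rcases eq_or_ne l [] with h | h
    · exact Or.inl h
    · exact Or.inr ⟨l.head h, l.getLast h, List.head?_eq_some_head h, List.getLast?_eq_some_getLast h, h⟩
  have hh1 := hh gs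
  have hh2 := hh as
  clear hh key hl
  have g1 : gs = [] → gs.IsChain (cmp Q) := by rintro rfl; exact List.isChain_nil
  have g2 : as = [] → as.IsChain (cmp Q) := by rintro rfl; exact List.isChain_nil
  have g3 : gs = [] → gs.IsChain (rl Q R) := by rintro rfl; exact List.isChain_nil
  have g4 : as = [] → as.IsChain (fun a b => ¬ rl Q R a b) := by
    rintro rfl; exact List.isChain_nil
  generalize List.IsChain (cmp Q) gs = p1 at *
  generalize List.IsChain (cmp Q) as = p2 at *
  generalize List.IsChain (rl Q R) gs = p3 at *
  generalize List.IsChain (fun a b => ¬ rl Q R a b) as = p4 at *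
  rcases hh2 with rfl | ⟨a, b, ha, hb, hab⟩ <;> rcases hh1 with rfl | ⟨c, d, hc, hd, hcd⟩
  · simp at hne
  · simp only [List.append_nil, List.nil_append, hc, hd]
    simp [cmp]
    grind
  · simp only [List.append_nil, List.nil_append, ha, hb]
    simp [cmp]
    grind
  · simp only [List.head?_append, List.getLast?_append, ha, hb, hc, hd]
    simp [cmp]
    grind

theorem sp_mem (hq : IsQuadMon Q R) {m : ℕ} {w : List Q.A} (h : w ≠ []) :
    BGmem Q R m (sp Q m w h) ↔ VV Q R m w := by
  unfold sp
  rw [bg_iff Q R hq (by simpa using h)]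
  simp only [List.take_append_drop, List.length_take]
  constructor
  · exact fun h => h.1
  · intro hv
    refine ⟨hv, by have := hv.2.1; omega, ?_, ?_⟩
    · intro a ha
      rw [List.head?_eq_some_head] at ha
      · simp at ha; rw [← ha]
    · intro a ha
      rw [List.head?_eq_some_head h] at ha
      simp at ha; rw [← ha]

theorem bet_zero (hq : IsQuadMon Q R) {m : ℕ} {w : List Q.A} (h : ¬ VV Q R m w) :
    bet k Q R m w = 0 := by
  unfold bet
  split_ifs with h1
  · rw [← sp_mem Q R hq h1] at h
    unfold bw
    rw [dif_neg h]
  · rfl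

theorem bet_single (hq : IsQuadMon Q R) {m : ℕ} {w : List Q.A} (h : VV Q R m w) :
    bet k Q R m w = Finsupp.single (⟨sp Q m w h.1, (sp_mem Q R hq h.1).2 h⟩ : BGt Q R m) 1 := by
  unfold bet
  rw [dif_pos h.1]
  unfold bw
  rw [dif_pos ((sp_mem Q R hq h.1).2 h)]

theorem E_mem (e : Q.V) : BGmem Q R 0 ((e, []), (e, [])) := by
  simp [BGmem, InB, InG, Ok, plen, AntiPar, psrc, ptgt, List.Chain']

theorem ind (hq : IsQuadMon Q R) {m : ℕ} (x : BGt Q R m) :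
    (m = 0 ∧ ∃ e, Finsupp.single x (1 : k) = Evec k Q R m e) ∨
    ∃ w, VV Q R m w ∧ Finsupp.single x (1 : k) = bet k Q R m w := by
  obtain ⟨⟨⟨v, as⟩, ⟨u, gs⟩⟩, hx⟩ := x
  by_cases hne : gs ++ as = []
  · left
    rw [List.append_eq_nil_iff] at hne
    obtain ⟨rfl, rfl⟩ := hne
    have h1 := hx.2.2.1
    have h2 := hx.2.2.2
    simp [plen, AntiPar, psrc, ptgt] at h1 h2
    subst h1
    subst h2
    refine ⟨rfl, v, ?_⟩
    unfold Evec bw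
    rw [dif_pos hx]
  · right
    have hx' := (bg_iff Q R hq hne).1 hx
    refine ⟨gs ++ as, hx'.1, ?_⟩
    rw [← bw_eq k Q R (x := ((v, as), (u, gs))) hx'.2.1 hne hx'.2.2.1 hx'.2.2.2]
    unfold bw
    rw [dif_pos hx]

/-- linear maps given by values on vertices and on words -/
noncomputable def lft {M : Type} [AddCommGroup M] [Module k M] (m : ℕ) (fe : Q.V → M)
    (f : List Q.A → M) : Chn k Q R m →ₗ[k] M := by
  classical
  exact Finsupp.linearCombination k (fun x : BGt Q R m =>
    if x.val.2.2 ++ x.val.1.2 = [] then fe x.val.1.1 else f (x.val.2.2 ++ x.val.1.2))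

theorem lft_E {M : Type} [AddCommGroup M] [Module k M] (fe : Q.V → M)
    (f : List Q.A → M) (e : Q.V) : lft k Q R 0 fe f (Evec k Q R 0 e) = fe e := by
  unfold Evec bw
  rw [dif_pos (E_mem Q R e)]
  unfold lft
  simp

theorem lft_bet (hq : IsQuadMon Q R) {M : Type} [AddCommGroup M] [Module k M] {m : ℕ}
    (fe : Q.V → M) (f : List Q.A → M) {w : List Q.A} (h : VV Q R m w) :
    lft k Q R m fe f (bet k Q R m w) = f w := by
  rw [bet_single k Q R hq h]
  unfold lft
  simp only [sp, Finsupp.linearCombination_single, one_smul, List.take_append_drop]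
  rw [if_neg h.1]

theorem lin_ext_s16 (hq : IsQuadMon Q R) {M : Type} [AddCommGroup M] [Module k M] {m : ℕ}
    (S : Submodule k M) (L : Chn k Q R m →ₗ[k] M) (h1 : m = 0 → ∀ e, L (Evec k Q R m e) ∈ S)
    (h2 : ∀ w, VV Q R m w → L (bet k Q R m w) ∈ S) (z : Chn k Q R m) : L z ∈ S := by
  induction z using Finsupp.induction_linear with
  | zero => simp
  | add f g hf hg => rw [map_add]; exact S.add_mem hf hg
  | single x c =>
    have : Finsupp.single x c = c • Finsupp.single x (1 : k) := by simp
    rw [this, map_smul]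
    apply S.smul_mem
    rcases ind k Q R hq x with ⟨h, e, he⟩ | ⟨w, hw, he⟩
    · rw [he]; exact h1 h e
    · rw [he]; exact h2 w hw

theorem bd_bet (hq : IsQuadMon Q R) {m : ℕ} {w : List Q.A} (h : VV Q R (m + 1) w) :
    bd k Q R m (bet k Q R (m + 1) w) =
      bet k Q R m w + ((-1 : k) ^ (m + 1)) • bet k Q R m (w.rotate 1) := by
  have hm := h.2.1
  have hmem := (sp_mem Q R hq h.1).2 h
  obtain ⟨gs, as, hw, hgs⟩ : ∃ gs as, w = gs ++ as ∧ gs.length = m + 1 :=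
    ⟨w.take (m+1), w.drop (m+1), by simp, by simp; omega⟩
  have hx : ∃ v u, sp Q (m+1) w h.1 = ((v, as), (u, gs)) := by
    unfold sp
    subst hw
    exact ⟨_, _, by simp only [← hgs, List.drop_left', List.take_left']; rfl⟩
  obtain ⟨v, u, hx⟩ := hx
  have hne : gs ++ as ≠ [] := by rw [← hw]; exact h.1
  have hx2 := hmem
  rw [hx, bg_iff Q R hq hne] at hx2
  obtain ⟨_, _, hv, hu⟩ := hx2
  rw [bet_single k Q R hq h]
  unfold bd
  rw [Finsupp.linearCombination_single, one_smul]
  unfold bdB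
  simp only [hx]
  congr 1
  · rcases List.eq_nil_or_concat gs with rfl | ⟨gs', g, rfl⟩
    · simp at hgs
    · have e1 : d1raw Q ((v, as), (u, gs' ++ [g])) = ((Q.src g, g :: as), (u, gs')) := by
        simp [d1raw]
      simp only [List.concat_eq_append] at *
      rw [e1, bw_eq]
      · simp [hw]
      · simpa using hgs
      · simp
      · simp
      · simpa using hu
  · congr 1
    rcases gs with _ | ⟨g, gs⟩
    · simp at hgs
    · have e1 : d2raw Q ((v, as), (u, g :: gs)) = ((v, as ++ [g]), (Q.tgt g, gs)) := by
        simp [d2raw]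
      rw [e1, bw_eq]
      · simp [hw]
      · simpa using hgs
      · simp
      · simpa [List.head?_append] using hv
      · have hc := h.2.2.1
        rw [hw] at hc
        simp only
        intro a ha
        have hc1 := hc.1
        have hc2 := hc.2
        simp only [List.cons_append, List.isChain_cons] at hc1
        by_cases hg : gs ++ as = []
        · rw [List.append_eq_nil_iff] at hg
          obtain ⟨rfl, rfl⟩ := hg
          simp at ha
          simp at hc2
          subst ha
          exact hc2.symm
        · have : a ∈ (gs ++ as).head? := by
            rw [← List.append_assoc, List.head?_append, List.head?_eq_some_head hg] at ha
            rw [List.head?_eq_some_head hg]; simpa using ha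
          exact (hc1.1 a this).symm
end

end P2sec

section P3sec

theorem cyc_iff (Q : Quiv) (p : PathDat Q) : IsCycle Q p ↔
    p.2 ≠ [] ∧ CycS (cmp Q) p.2 ∧ ∀ a ∈ p.2.head?, Q.src a = p.1 := by
  obtain ⟨v, l⟩ := p
  unfold IsCycle Ok CycS psrc ptgt
  rcases List.eq_nil_or_concat l with rfl | ⟨l', b, rfl⟩
  · simp
  · cases hh : (l' ++ [b]).head? with
    | none => simp at hh
    | some a =>
      simp only [List.concat_eq_append, hh, List.getLast?_append, List.getLast?_singleton,
        Option.mem_def, Option.some_or, Option.elim_some, Option.some.injEq, forall_eq']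
      unfold List.Chain'
      constructor
      · rintro ⟨⟨h1, h2⟩, h3, h4⟩
        exact ⟨h3, ⟨h1, by unfold cmp; rw [h2, ← h4]⟩, h2⟩
      · rintro ⟨h1, ⟨h2, h3⟩, h4⟩
        refine ⟨⟨h2, h4⟩, h1, ?_⟩
        unfold cmp at h3
        rw [h3, h4]

theorem pow_chain {α : Type} (S : α → α → Prop) (l : List α) (h : l ≠ []) :
    (powL l 2).IsChain S ↔ ∀ i, Pz S l i := by
  rw [← cycS_iff h]
  simp only [powL, List.append_nil, List.isChain_append]
  unfold CycS
  tauto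

theorem complete_iff (Q : Quiv) (R : Set (Q.A × Q.A)) (p : PathDat Q) : Complete Q R p ↔
    IsCycle Q p ∧ ∀ i, Pz (rl Q R) p.2 i := by
  unfold Complete InG Ok powP List.Chain'
  constructor
  · rintro ⟨h, h1, h2⟩
    exact ⟨h, (pow_chain _ _ h.2.1).1 h2⟩
  · rintro ⟨h, h1⟩
    refine ⟨h, ⟨?_, ?_⟩, (pow_chain _ _ h.2.1).2 h1⟩
    · exact (pow_chain _ _ h.2.1).2 ((cycS_iff h.2.1).1 ((cyc_iff Q p).1 h).2.1)
    · have := ((cyc_iff Q p).1 h).2.2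
      obtain ⟨v, l⟩ := p
      cases l with
      | nil => simp [powL]
      | cons a l => simpa [powL] using this

theorem cocomplete_iff (Q : Quiv) (R : Set (Q.A × Q.A)) (p : PathDat Q) : Cocomplete Q R p ↔
    IsCycle Q p ∧ ∀ i, ¬ Pz (rl Q R) p.2 i := by
  unfold Cocomplete InB Ok powP List.Chain'
  constructor
  · rintro ⟨h, h1, h2⟩
    exact ⟨h, fun i => (pz_not h.2.1).1 ((pow_chain _ _ h.2.1).1 h2 i)⟩
  · rintro ⟨h, h1⟩
    refine ⟨h, ⟨?_, ?_⟩, (pow_chain _ _ h.2.1).2 (fun i => (pz_not h.2.1).2 (h1 i))⟩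
    · exact (pow_chain _ _ h.2.1).2 ((cycS_iff h.2.1).1 ((cyc_iff Q p).1 h).2.1)
    · have := ((cyc_iff Q p).1 h).2.2
      obtain ⟨v, l⟩ := p
      cases l with
      | nil => simp [powL]
      | cons a l => simpa [powL] using this

theorem rotP_rotate (Q : Quiv) (p : PathDat Q) : (rotP Q p).2.rotate 1 = p.2 := by
  obtain ⟨v, l⟩ := p
  rcases List.eq_nil_or_concat l with rfl | ⟨l', b, rfl⟩
  · simp [rotP]
  · simp [rotP]

theorem rotP_len (Q : Quiv) (p : PathDat Q) : (rotP Q p).2.length = p.2.length := by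
  rw [← rotP_rotate Q p, List.length_rotate]

theorem rotP_pz (Q : Quiv) (S : Q.A → Q.A → Prop) (p : PathDat Q) (h : p.2 ≠ []) :
    (∀ i, Pz S (rotP Q p).2 i) ↔ ∀ i, Pz S p.2 i := by
  have key : ∀ i, Pz S p.2 i ↔ Pz S (rotP Q p).2 (i+1) := by
    intro i
    rw [← pz_rot, rotP_rotate]
  have hn : 0 < p.2.length := List.length_pos_iff.2 h
  constructor
  · intro h i; exact (key i).2 (h _)
  · intro h i
    rw [← pz_add, rotP_len]
    have := (key (i + p.2.length - 1)).1 (h _)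
    rwa [show i + p.2.length - 1 + 1 = i + p.2.length by omega] at this

theorem rotP_cyc (Q : Quiv) (p : PathDat Q) (h : IsCycle Q p) : IsCycle Q (rotP Q p) := by
  rw [cyc_iff] at *
  obtain ⟨h1, h2, h3⟩ := h
  have hne : (rotP Q p).2 ≠ [] := by
    rw [← List.length_pos_iff, rotP_len]; exact List.length_pos_iff.2 h1
  refine ⟨hne, ?_, ?_⟩
  · rw [cycS_iff hne, rotP_pz Q _ p h1, ← cycS_iff h1]; exact h2
  · obtain ⟨v, l⟩ := p
    rcases List.eq_nil_or_concat l with rfl | ⟨l', b, rfl⟩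
    · simp at h1
    · simp [rotP]

theorem rotI_succ (Q : Quiv) (i : ℕ) (p : PathDat Q) : rotI Q (i+1) p = rotP Q (rotI Q i p) :=
  Function.iterate_succ_apply' _ _ _

theorem rotI_add (Q : Quiv) (i j : ℕ) (p : PathDat Q) :
    rotI Q (i+j) p = rotI Q i (rotI Q j p) :=
  Function.iterate_add_apply _ _ _ _

theorem rotI_cyc (Q : Quiv) (i : ℕ) (p : PathDat Q) (h : IsCycle Q p) : IsCycle Q (rotI Q i p) := by
  induction i with
  | zero => exact h
  | succ i ih => rw [rotI_succ]; exact rotP_cyc Q _ ih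

theorem rotI_len (Q : Quiv) (i : ℕ) (p : PathDat Q) : (rotI Q i p).2.length = p.2.length := by
  induction i with
  | zero => rfl
  | succ i ih => rw [rotI_succ, rotP_len, ih]

theorem rotI_rotate (Q : Quiv) (i : ℕ) (p : PathDat Q) :
    (rotI Q (i+1) p).2.rotate 1 = (rotI Q i p).2 := by
  rw [rotI_succ, rotP_rotate]

theorem rotI_rotate' (Q : Quiv) (i : ℕ) (p : PathDat Q) :
    (rotI Q i p).2.rotate i = p.2 := by
  induction i with
  | zero => simp [rotI]
  | succ i ih => rw [add_comm i 1, ← List.rotate_rotate, add_comm 1 i, rotI_rotate, ih]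

theorem rotI_pz (Q : Quiv) (S : Q.A → Q.A → Prop) (j : ℕ) (p : PathDat Q) (h : IsCycle Q p) :
    (∀ i, Pz S (rotI Q j p).2 i) ↔ ∀ i, Pz S p.2 i := by
  induction j with
  | zero => rfl
  | succ j ih => rw [rotI_succ, rotP_pz Q _ _ (rotI_cyc Q j p h).2.1, ih]

theorem cyc_ext (Q : Quiv) {p q : PathDat Q} (hp : IsCycle Q p) (hq : IsCycle Q q)
    (h : p.2 = q.2) : p = q := by
  rw [cyc_iff] at *
  obtain ⟨v, l⟩ := p
  obtain ⟨u, l'⟩ := q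
  simp only at h
  subst h
  obtain ⟨a, l, rfl⟩ := List.exists_cons_of_ne_nil hp.1
  have h1 := hp.2.2 a (by simp)
  have h2 := hq.2.2 a (by simp)
  simp only at h1 h2
  rw [← h1, ← h2]

theorem rotI_inj (Q : Quiv) (i : ℕ) {p q : PathDat Q} (hp : IsCycle Q p) (hq : IsCycle Q q)
    (h : rotI Q i p = rotI Q i q) : p = q := by
  apply cyc_ext Q hp hq
  rw [← rotI_rotate' Q i p, h, rotI_rotate']

theorem rotI_length (Q : Quiv) {p : PathDat Q} (hp : IsCycle Q p) :
    rotI Q p.2.length p = p := by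
  apply cyc_ext Q (rotI_cyc Q _ p hp) hp
  have h2 := List.rotate_length (l := (rotI Q p.2.length p).2)
  rw [rotI_len] at h2
  exact h2.symm.trans (rotI_rotate' Q p.2.length p)

theorem period_mem (Q : Quiv) {p : PathDat Q} (hp : IsCycle Q p) :
    1 ≤ periodP Q p ∧ rotI Q (periodP Q p) p = p := by
  have : periodP Q p ∈ {i : ℕ | 1 ≤ i ∧ rotI Q i p = p} :=
    Nat.sInf_mem ⟨p.2.length, List.length_pos_iff.2 hp.2.1, rotI_length Q hp⟩
  exact this

theorem rotI_period (Q : Quiv) {p : PathDat Q} (hp : IsCycle Q p) (i : ℕ) :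
    rotI Q (i + periodP Q p) p = rotI Q i p := by
  rw [rotI_add, (period_mem Q hp).2]

theorem rotI_inj2 (Q : Quiv) {p : PathDat Q} (hp : IsCycle Q p) {i j : ℕ} 
    (hij : i ≤ j) (hj : j < periodP Q p) (h : rotI Q i p = rotI Q j p) : i = j := by
  by_contra hne
  obtain ⟨d, rfl⟩ := Nat.exists_eq_add_of_le hij
  rw [rotI_add] at h
  have h1 := rotI_inj Q i hp (rotI_cyc Q d p hp) h
  have : periodP Q p ≤ d := Nat.sInf_le ⟨by omega, h1.symm⟩
  omega

theorem rotI_mod (Q : Quiv) {p : PathDat Q} (hp : IsCycle Q p) (i : ℕ) :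
    rotI Q (i % periodP Q p) p = rotI Q i p := by
  have key : ∀ n, rotI Q (i % periodP Q p + periodP Q p * n) p = rotI Q (i % periodP Q p) p := by
    intro n
    induction n with
    | zero => simp
    | succ n ih => rw [Nat.mul_succ, ← add_assoc, rotI_period Q hp, ih]
  rw [← key (i / periodP Q p), Nat.mod_add_div]

theorem rotE_symm (Q : Quiv) {p q : PathDat Q} (hp : IsCycle Q p) (h : RotEquiv Q p q) :
    RotEquiv Q q p := by
  obtain ⟨i, rfl⟩ := h
  have h0 := (period_mem Q hp).1
  refine ⟨i * periodP Q p - i, ?_⟩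
  rw [← rotI_add, Nat.sub_add_cancel (Nat.le_mul_of_pos_right _ h0), ← rotI_mod Q hp]
  simp [rotI]

/-- abstract data of the circuits contributing to homology -/
structure Cls (Q : Quiv) (R : Set (Q.A × Q.A)) where
  I : Type
  D : I → ℕ
  r : I → ℕ
  W : I → ℕ → List Q.A
  hr : ∀ c, 1 ≤ r c
  per : ∀ c, W c (r c) = W c 0
  rot : ∀ c i, (W c (i+1)).rotate 1 = W c i
  inj : ∀ c i c' j, i < r c → j < r c' → W c i = W c' j → c = c' ∧ i = j
  val : ∀ c i m, VV Q R m (W c i) ↔ m = D c ∨ m = D c + 1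
  alt : ∀ m w, VV Q R m w → Mix Q R w ∨ ∃ c i, i < r c ∧ W c i = w
  nmix : ∀ c i, ¬ Mix Q R (W c i)

open Classical in
/-- the circuits from the sets of representatives -/
noncomputable def mkCls (Q : Quiv) (R : Set (Q.A × Q.A)) (Rc Rg : Set (PathDat Q))
    (hRc : IsRepSet Q Rc (Cocomplete Q R)) (hRg : IsRepSet Q Rg (Complete Q R)) : Cls Q R where
  I := {c : PathDat Q // c ∈ Rc ∨ c ∈ Rg}
  D := fun c => if c.1 ∈ Rc then 0 else c.1.2.length - 1
  r := fun c => periodP Q c.1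
  W := fun c i => (rotI Q i c.1).2
  hr := by
    rintro ⟨c, hc | hc⟩
    · exact (period_mem Q (hRc.1 c hc).1).1
    · exact (period_mem Q (hRg.1 c hc).1).1
  per := by
    rintro ⟨c, hc | hc⟩
    · simp only [(period_mem Q (hRc.1 c hc).1).2]; rfl
    · simp only [(period_mem Q (hRg.1 c hc).1).2]; rfl
  rot := fun c i => rotI_rotate Q i c.1
  inj := by
    rintro ⟨c, hc⟩ i ⟨c', hc'⟩ j hi hj h
    simp only at hi hj h
    have e1 : IsCycle Q c := hc.elim (fun h => (hRc.1 c h).1) (fun h => (hRg.1 c h).1)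
    have e2 : IsCycle Q c' := hc'.elim (fun h => (hRc.1 c' h).1) (fun h => (hRg.1 c' h).1)
    have e3 : rotI Q i c = rotI Q j c' := cyc_ext Q (rotI_cyc Q i c e1) (rotI_cyc Q j c' e2) h
    have e4 : RotEquiv Q c (rotI Q i c) := ⟨i, rfl⟩
    have e5 : RotEquiv Q (rotI Q i c) c := rotE_symm Q e1 e4
    have e6 : RotEquiv Q (rotI Q i c) c' := rotE_symm Q e2 ⟨j, e3.symm⟩
    have pzr := fun S => (rotI_pz Q S i c e1).symm.trans ((by rw [e3] : _ ↔ _).trans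
      (rotI_pz Q S j c' e2))
    have hcc : c = c' := by
      rcases hc with hc | hc <;> rcases hc' with hc' | hc'
      · have h1 := (cocomplete_iff Q R c).1 (hRc.1 c hc)
        have h2 : Cocomplete Q R (rotI Q i c) := (cocomplete_iff Q R _).2
          ⟨rotI_cyc Q i c e1, fun n => (pz_not (rotI_cyc Q i c e1).2.1).1
            ((rotI_pz Q _ i c e1).2 (fun n => (pz_not e1.2.1).2 (h1.2 n)) n)⟩
        exact (hRc.2 _ h2).unique ⟨hc, e5⟩ ⟨hc', e6⟩
      · have h1 := (cocomplete_iff Q R c).1 (hRc.1 c hc)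
        have h2 := (complete_iff Q R c').1 (hRg.1 c' hc')
        exact absurd ((pzr _).2 h2.2 0) (h1.2 0)
      · have h1 := (cocomplete_iff Q R c').1 (hRc.1 c' hc')
        have h2 := (complete_iff Q R c).1 (hRg.1 c hc)
        exact absurd ((pzr _).1 h2.2 0) (h1.2 0)
      · have h1 := (complete_iff Q R c).1 (hRg.1 c hc)
        have h2 : Complete Q R (rotI Q i c) := (complete_iff Q R _).2
          ⟨rotI_cyc Q i c e1, ((rotI_pz Q _ i c e1).2 h1.2)⟩
        exact (hRg.2 _ h2).unique ⟨hc, e5⟩ ⟨hc', e6⟩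
    subst hcc
    refine ⟨rfl, ?_⟩
    rcases le_total i j with hij | hij
    · exact rotI_inj2 Q e1 hij hj e3
    · exact (rotI_inj2 Q e1 hij hi e3.symm).symm
  val := by
    rintro ⟨c, hc⟩ i m
    simp only
    have e1 : IsCycle Q c := hc.elim (fun h => (hRc.1 c h).1) (fun h => (hRg.1 c h).1)
    have e2 := rotI_cyc Q i c e1
    have e3 := (cyc_iff Q _).1 e2
    by_cases h : c ∈ Rc
    · have h1 := (cocomplete_iff Q R c).1 (hRc.1 c h)
      rw [if_pos h, VV_co Q R e3.1 e3.2.1]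
      intro n
      exact (pz_not e2.2.1).1 ((rotI_pz Q _ i c e1).2 (fun n => (pz_not e1.2.1).2 (h1.2 n)) n)
    · have h1 := (complete_iff Q R c).1 (hRg.1 c (hc.resolve_left h))
      rw [if_neg h, VV_com Q R e3.1 e3.2.1 ((rotI_pz Q _ i c e1).2 h1.2), rotI_len]
  alt := by
    intro m w h
    by_cases hm : Mix Q R w
    · exact Or.inl hm
    right
    obtain ⟨h1, h2, h3, -⟩ := h
    have hcy : IsCycle Q (Q.src (w.head h1), w) := by
      rw [cyc_iff]
      refine ⟨h1, h3, ?_⟩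
      obtain ⟨a, l, rfl⟩ := List.exists_cons_of_ne_nil h1
      simp
    have fin : ∀ c, ∀ hc : c ∈ Rc ∨ c ∈ Rg, RotEquiv Q (Q.src (w.head h1), w) c →
        ∃ (c : {c : PathDat Q // c ∈ Rc ∨ c ∈ Rg}) (i : ℕ), i < periodP Q c.1 ∧
          (rotI Q i c.1).2 = w := by
      intro c hc hE
      have e1 : IsCycle Q c := hc.elim (fun h => (hRc.1 c h).1) (fun h => (hRg.1 c h).1)
      obtain ⟨i, hi⟩ := rotE_symm Q hcy hE
      refine ⟨⟨c, hc⟩, i % periodP Q c, Nat.mod_lt _ (period_mem Q e1).1, ?_⟩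
      rw [rotI_mod Q e1, hi]
    unfold Mix at hm
    by_cases hp : ∀ i, Pz (rl Q R) w i
    · obtain ⟨c, ⟨hc, hE⟩, -⟩ := hRg.2 _ ((complete_iff Q R (Q.src (w.head h1), w)).2 ⟨hcy, hp⟩)
      exact fin c (Or.inr hc) hE
    · have hp' : ∀ i, ¬ Pz (rl Q R) w i := by
        intro i hi
        push Not at hp
        exact hm ⟨⟨i, hi⟩, hp⟩
      obtain ⟨c, ⟨hc, hE⟩, -⟩ := hRc.2 _ ((cocomplete_iff Q R (Q.src (w.head h1), w)).2 ⟨hcy, hp'⟩)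
      exact fin c (Or.inl hc) hE
  nmix := by
    rintro ⟨c, hc⟩ i ⟨⟨n, hn⟩, ⟨n', hn'⟩⟩
    simp only at hn hn'
    rcases hc with hc | hc
    · have h1 := (cocomplete_iff Q R c).1 (hRc.1 c hc)
      exact (pz_not (rotI_cyc Q i c h1.1).2.1).1 ((rotI_pz Q _ i c h1.1).2
        (fun n => (pz_not h1.1.2.1).2 (h1.2 n)) n) hn
    · have h1 := (complete_iff Q R c).1 (hRg.1 c hc)
      exact hn' ((rotI_pz Q _ i c h1.1).2 h1.2 n')


end P3sec

section P4sec

variable (k : Type) [Field k] (Q : Quiv) (R : Set (Q.A × Q.A)) (K : Cls Q R)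

/-- the sign of a circuit -/
def ep (c : K.I) : k := (-1 : k) ^ (K.D c)

/-- partial sums -/
noncomputable def SS (m : ℕ) (c : K.I) : ℕ → Chn k Q R (m + 1)
  | 0 => 0
  | j + 1 => bet k Q R (m+1) (K.W c (j+1)) + ep k Q R K c • SS m c j

theorem ep_sq (c : K.I) : ep k Q R K c * ep k Q R K c = 1 := by
  unfold ep
  rw [← pow_add, ← two_mul, pow_mul]; simp

theorem ep_pow (c : K.I) (n : ℕ) : ep k Q R K c ^ n = 1 ∨ ep k Q R K c ^ n = -1 := by
  unfold ep
  rw [← pow_mul]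
  exact neg_one_pow_eq_or k _

theorem bd_X (hq : IsQuadMon Q R) {m : ℕ} (c : K.I) (hc : K.D c = m) (j : ℕ) :
    bd k Q R m (bet k Q R (m+1) (K.W c (j+1))) =
      bet k Q R m (K.W c (j+1)) - ep k Q R K c • bet k Q R m (K.W c j) := by
  rw [bd_bet k Q R hq ((K.val c _ _).2 (Or.inr (by omega))), K.rot, pow_succ]
  unfold ep
  rw [hc]
  module

theorem bd_S (hq : IsQuadMon Q R) {m : ℕ} (c : K.I) (hc : K.D c = m) (j : ℕ) :
    bd k Q R m (SS k Q R K m c j) =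
      bet k Q R m (K.W c j) - ep k Q R K c ^ j • bet k Q R m (K.W c 0) := by
  induction j with
  | zero => simp [SS]
  | succ j ih =>
    rw [SS, map_add, map_smul, ih, bd_X k Q R K hq c hc, pow_succ]
    module

theorem S_sum {m : ℕ} (c : K.I) (n : ℕ) : SS k Q R K m c n =
    ep k Q R K c ^ n • ∑ j ∈ Finset.range n, ep k Q R K c ^ (j+1) • bet k Q R (m+1) (K.W c (j+1)) := by
  induction n with
  | zero => simp [SS]
  | succ n ih =>
    rw [SS, ih, Finset.sum_range_succ, smul_add, smul_smul, smul_smul, ← pow_add,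
      ← two_mul, pow_mul, pow_two, ep_sq, pow_succ]
    simp only [one_pow]
    module

theorem S_r {m : ℕ} (c : K.I) (h : ep k Q R K c ^ K.r c = 1) : SS k Q R K m c (K.r c) =
    ∑ j ∈ Finset.range (K.r c), ep k Q R K c ^ j • bet k Q R (m+1) (K.W c j) := by
  have h1 := Finset.sum_range_succ (fun j => ep k Q R K c ^ j • bet k Q R (m+1) (K.W c j)) (K.r c)
  have h2 := Finset.sum_range_succ' (fun j => ep k Q R K c ^ j • bet k Q R (m+1) (K.W c j)) (K.r c)
  rw [S_sum, h, one_smul]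
  rw [h2, h, K.per] at h1
  simpa using h1

open Classical in
/-- the correction term -/
noncomputable def H0 (m : ℕ) (c : K.I) : Chn k Q R (m+1) :=
  if ep k Q R K c ^ K.r c = 1 then 0 else (2 : k)⁻¹ • SS k Q R K m c (K.r c)

/-- the value of the homotopy on classes -/
noncomputable def HH (m : ℕ) (c : K.I) (i : ℕ) : Chn k Q R (m+1) :=
  SS k Q R K m c i + ep k Q R K c ^ i • H0 k Q R K m c

open Classical in
/-- the homotopy on words -/
noncomputable def fm (m : ℕ) (w : List Q.A) : Chn k Q R (m+1) :=
  if h : ∃ c : K.I, ∃ i, i < K.r c ∧ K.W c i = w then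
    (if m = K.D h.choose then HH k Q R K m h.choose h.choose_spec.choose else 0)
  else bet k Q R (m+1) w

theorem fm_W (m : ℕ) (c : K.I) (i : ℕ) (hi : i < K.r c) :
    fm k Q R K m (K.W c i) = if m = K.D c then HH k Q R K m c i else 0 := by
  have h : ∃ c' : K.I, ∃ j, j < K.r c' ∧ K.W c' j = K.W c i := ⟨c, i, hi, rfl⟩
  unfold fm
  rw [dif_pos h]
  have e := K.inj _ _ _ _ h.choose_spec.choose_spec.1 hi h.choose_spec.choose_spec.2
  rw [e.2]
  have key : ∀ c', c' = c → (if m = K.D c' then HH k Q R K m c' i else 0) =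
    if m = K.D c then HH k Q R K m c i else 0 := by rintro _ rfl; rfl
  exact key _ e.1

theorem fm_mix (m : ℕ) (w : List Q.A) (h : Mix Q R w) : fm k Q R K m w = bet k Q R (m+1) w := by
  unfold fm
  rw [dif_neg]
  rintro ⟨c, i, hi, rfl⟩
  exact K.nmix c i h

/-- the homotopy -/
noncomputable def hm (m : ℕ) : Chn k Q R m →ₗ[k] Chn k Q R (m+1) :=
  lft k Q R m (fun _ => 0) (fm k Q R K m)

theorem hm_W (hq : IsQuadMon Q R) (m : ℕ) (c : K.I) (i : ℕ) (hi : i < K.r c) :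
    hm k Q R K m (bet k Q R m (K.W c i)) = if m = K.D c then HH k Q R K m c i else 0 := by
  by_cases h : VV Q R m (K.W c i)
  · unfold hm
    rw [lft_bet k Q R hq _ _ h, fm_W k Q R K m c i hi]
  · rw [bet_zero k Q R hq h, map_zero]
    rw [if_neg]
    intro h'
    exact h ((K.val _ _ _).2 (Or.inl h'))

theorem hm_mix (hq : IsQuadMon Q R) (m : ℕ) (w : List Q.A) (h : Mix Q R w) (hv : VV Q R m w) :
    hm k Q R K m (bet k Q R m w) = bet k Q R (m+1) w := by
  unfold hm
  rw [lft_bet k Q R hq _ _ hv, fm_mix k Q R K m w h]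

theorem mix_rot {w : List Q.A} (h : Mix Q R w) : Mix Q R (w.rotate 1) := by
  obtain ⟨⟨i, hi⟩, j, hj⟩ := h
  by_cases hw : w.length = 0
  · rw [List.length_eq_zero_iff] at hw
    subst hw
    exact ⟨⟨i, hi⟩, j, hj⟩
  refine ⟨⟨i + w.length - 1, ?_⟩, j + w.length - 1, ?_⟩
  · rw [pz_rot, show i + w.length - 1 + 1 = i + w.length by omega, pz_add]; exact hi
  · rw [pz_rot, show j + w.length - 1 + 1 = j + w.length by omega, pz_add]; exact hj

/-- the generators, abstractly -/
def Gen (m : ℕ) : Set (Chn k Q R m) :=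
  {x | m = 0 ∧ ∃ e, x = Evec k Q R m e} ∪
  {x | ∃ c, K.D c = m ∧ ep k Q R K c ^ K.r c = 1 ∧ x = bet k Q R m (K.W c 0)} ∪
  {x | ∃ c, K.D c + 1 = m ∧ ep k Q R K c ^ K.r c = 1 ∧
    x = ∑ j ∈ Finset.range (K.r c), ep k Q R K c ^ j • bet k Q R m (K.W c j)}

theorem U_mem (hq : IsQuadMon Q R) (m : ℕ) (c : K.I) (hc : K.D c = m) (i : ℕ) :
    bet k Q R m (K.W c i) - bd k Q R m (HH k Q R K m c i) ∈ Submodule.span k (Gen k Q R K m) := by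
  have key : bet k Q R m (K.W c 0) - bd k Q R m (H0 k Q R K m c) ∈
      Submodule.span k (Gen k Q R K m) := by
    unfold H0
    split_ifs with h
    · rw [map_zero, sub_zero]
      exact Submodule.subset_span (Or.inl (Or.inr ⟨c, hc, h, rfl⟩))
    · have h' := (ep_pow k Q R K c (K.r c)).resolve_left h
      have h2 : (2 : k) ≠ 0 := by
        intro h2
        apply h
        rw [h']
        linear_combination -h2
      rw [map_smul, bd_S k Q R K hq c hc, h', K.per]
      have : bet k Q R m (K.W c 0) - (2:k)⁻¹ • (bet k Q R m (K.W c 0) - (-1 : k) • bet k Q R m (K.W c 0)) = 0 := by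
        match_scalars
        field_simp
        ring
      rw [this]
      exact Submodule.zero_mem _
  unfold HH
  rw [map_add, map_smul, bd_S k Q R K hq c hc]
  have : bet k Q R m (K.W c i) - (bet k Q R m (K.W c i) - ep k Q R K c ^ i • bet k Q R m (K.W c 0) +
      ep k Q R K c ^ i • bd k Q R m (H0 k Q R K m c)) = ep k Q R K c ^ i •
      (bet k Q R m (K.W c 0) - bd k Q R m (H0 k Q R K m c)) := by module
  rw [this]
  exact Submodule.smul_mem _ _ key

theorem X_mem (m : ℕ) (c : K.I) (hc : K.D c = m) :
    SS k Q R K m c (K.r c) - (1 - ep k Q R K c ^ K.r c) • H0 k Q R K m c ∈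
      Submodule.span k (Gen k Q R K (m+1)) := by
  unfold H0
  split_ifs with h
  · rw [smul_zero, sub_zero, S_r k Q R K c h]
    exact Submodule.subset_span (Or.inr ⟨c, by omega, h, rfl⟩)
  · have h' := (ep_pow k Q R K c (K.r c)).resolve_left h
    have h2 : (2 : k) ≠ 0 := by
      intro h2
      apply h
      rw [h']
      linear_combination -h2
    rw [h', smul_smul]
    have : (1 - (-1) : k) * 2⁻¹ = 1 := by field_simp; ring
    rw [this, one_smul, sub_self]
    exact Submodule.zero_mem _

theorem main0 (hq : IsQuadMon Q R) (z : Chn k Q R 0) :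
    z - bd k Q R 0 (hm k Q R K 0 z) ∈ Submodule.span k (Gen k Q R K 0) := by
  refine lin_ext_s16 k Q R hq (Submodule.span k (Gen k Q R K 0))
    (LinearMap.id - (bd k Q R 0).comp (hm k Q R K 0)) ?_ ?_ z
  · intro _ e
    simp only [LinearMap.sub_apply, LinearMap.id_apply, LinearMap.comp_apply]
    unfold hm
    rw [lft_E, map_zero, sub_zero]
    exact Submodule.subset_span (Or.inl (Or.inl ⟨rfl, e, rfl⟩))
  · intro w hw
    simp only [LinearMap.sub_apply, LinearMap.id_apply, LinearMap.comp_apply]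
    rcases K.alt 0 w hw with hmx | ⟨c, i, hi, rfl⟩
    · rw [hm_mix k Q R K hq 0 w hmx hw]
      have h1 : VV Q R 1 w := (VV_one Q R hw).2 (by simp)
      have h2 : ¬ VV Q R 0 (w.rotate 1) := by
        intro h2
        have := (VV_two Q R hw h2 hmx).1 h1
        simp at this
      rw [bd_bet k Q R hq h1, bet_zero k Q R hq h2]
      simp
    · rw [hm_W k Q R K hq 0 c i hi]
      rcases (K.val _ _ _).1 hw with h | h
      · rw [if_pos h]
        exact U_mem k Q R K hq 0 c h.symm i
      · omega

theorem main1 (hq : IsQuadMon Q R) (m : ℕ) (z : Chn k Q R (m+1)) :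
    z - bd k Q R (m+1) (hm k Q R K (m+1) z) - hm k Q R K m (bd k Q R m z)
      ∈ Submodule.span k (Gen k Q R K (m+1)) := by
  refine lin_ext_s16 k Q R hq (Submodule.span k (Gen k Q R K (m+1)))
    (LinearMap.id - (bd k Q R (m+1)).comp (hm k Q R K (m+1)) - (hm k Q R K m).comp (bd k Q R m))
      ?_ ?_ z
  · intro h
    omega
  · intro w hw
    simp only [LinearMap.sub_apply, LinearMap.id_apply, LinearMap.comp_apply]
    rcases K.alt (m+1) w hw with hmx | ⟨c, i, hi, rfl⟩
    · rw [hm_mix k Q R K hq (m+1) w hmx hw, bd_bet k Q R hq hw, map_add, map_smul]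
      have one := VV_one Q R hw
      have two := fun h => VV_two Q R hw h hmx
      simp only [le_add_iff_nonneg_left, zero_le, true_and, Nat.add_sub_cancel] at one two
      have hmr := mix_rot Q R hmx
      by_cases h1 : VV Q R (m+1+1) w
      · rw [bd_bet k Q R hq h1, bet_zero k Q R hq (one.1 h1)]
        have h3 : hm k Q R K m (bet k Q R m (w.rotate 1)) = bet k Q R (m+1) (w.rotate 1) := by
          by_cases h4 : VV Q R m (w.rotate 1)
          · exact hm_mix k Q R K hq m _ hmr h4
          · rw [bet_zero k Q R hq h4, map_zero, bet_zero k Q R hq]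
            intro h5
            exact h4 ((two h5).1 h1)
        rw [h3, map_zero]
        convert Submodule.zero_mem _
        rw [pow_succ _ (m+1)]
        module
      · have h2 : VV Q R m w := by
          by_contra h2
          exact h1 (one.2 h2)
        rw [bet_zero k Q R hq h1, hm_mix k Q R K hq m w hmx h2]
        have h3 : hm k Q R K m (bet k Q R m (w.rotate 1)) = 0 := by
          by_cases h4 : VV Q R m (w.rotate 1)
          · rw [hm_mix k Q R K hq m _ hmr h4, bet_zero k Q R hq]
            intro h5
            exact h1 ((two h5).2 h4)
          · rw [bet_zero k Q R hq h4, map_zero]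
        rw [h3]
        simp
    · rw [hm_W k Q R K hq (m+1) c i hi]
      obtain ⟨j, hj, hj'⟩ : ∃ j, j + 1 ≤ K.r c ∧ K.W c (j+1) = K.W c i := by
        rcases i with _ | i
        · have := K.hr c
          exact ⟨K.r c - 1, by omega, by rw [Nat.sub_add_cancel this, K.per]⟩
        · exact ⟨i, hi.le, rfl⟩
      rcases (K.val _ _ _).1 hw with h | h
      · rw [if_pos h, bd_bet k Q R hq hw, ← hj', K.rot]
        have hz : ∀ n, bet k Q R m (K.W c n) = 0 := by
          intro n
          apply bet_zero k Q R hq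
          rw [K.val]
          omega
        rw [hz, hz, smul_zero, add_zero, map_zero, sub_zero, hj']
        exact U_mem k Q R K hq (m+1) c h.symm i
      · have hD : K.D c = m := by omega
        rw [if_neg (by omega), map_zero, sub_zero]
        rcases i with _ | i
        · clear hj hj'
          obtain ⟨n, hn⟩ : ∃ n, K.r c = n + 1 := ⟨K.r c - 1, by have := K.hr c; omega⟩
          have hb := bd_X k Q R K hq c hD n
          have hx := X_mem k Q R K m c hD
          have hp := K.per c
          rw [hn] at hp hx
          rw [hp] at hb
          rw [hb, map_sub, map_smul, hm_W k Q R K hq m c 0 (by omega),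
            hm_W k Q R K hq m c n (by omega), if_pos hD.symm, if_pos hD.symm]
          convert hx using 1
          unfold HH
          rw [SS, SS, hp, pow_zero, pow_succ]
          module
        · rw [bd_X k Q R K hq c hD, map_sub, map_smul, hm_W k Q R K hq m c (i+1) hi,
            hm_W k Q R K hq m c i (by omega), if_pos hD.symm, if_pos hD.symm]
          convert Submodule.zero_mem _
          unfold HH
          rw [SS, pow_succ]
          module

theorem span_part (hq : IsQuadMon Q R) (m : ℕ) (z : Chn k Q R m) (hz : z ∈ ZSp k Q R m) :
    ∃ y, z - bd k Q R m y ∈ Submodule.span k (Gen k Q R K m) := by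
  refine ⟨hm k Q R K m z, ?_⟩
  rcases m with _ | m
  · exact main0 k Q R K hq z
  · have := main1 k Q R K hq m z
    have hz' : bd k Q R m z = 0 := hz
    rwa [hz', map_zero, sub_zero] at this

theorem cyc_part (hq : IsQuadMon Q R) (m : ℕ) (z : Chn k Q R m) (hz : z ∈ Gen k Q R K m) :
    z ∈ ZSp k Q R m := by
  rcases m with _ | m
  · exact Submodule.mem_top
  · change bd k Q R m z = 0
    rcases hz with (⟨h, -⟩ | ⟨c, hc, h, rfl⟩) | ⟨c, hc, h, rfl⟩
    · omega
    · obtain ⟨j, hj'⟩ : ∃ j, K.W c (j+1) = K.W c 0 := 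
        ⟨K.r c - 1, by rw [Nat.sub_add_cancel (K.hr c), K.per]⟩
      rw [bd_bet k Q R hq ((K.val _ _ _).2 (Or.inl hc.symm)), ← hj', K.rot]
      have hz : ∀ n, bet k Q R m (K.W c n) = 0 := by
        intro n
        apply bet_zero k Q R hq
        rw [K.val]
        omega
      rw [hz, hz]; simp
    · have hD : K.D c = m := by omega
      rw [← S_r k Q R K c h, bd_S k Q R K hq c hD, h, K.per]
      simp

theorem fg_of (m : ℕ) (G : Set (Chn k Q R m)) (h1 : ∀ x ∈ G, x ∈ ZSp k Q R m)
    (h2 : ∀ z ∈ ZSp k Q R m, ∃ y, z - bd k Q R m y ∈ Submodule.span k G)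
    (h3 : ∀ g ∈ G, ∃ φ : Chn k Q R m →ₗ[k] k, φ g = 1 ∧ (∀ g' ∈ G, g' ≠ g → φ g' = 0) ∧
      ∀ y, φ (bd k Q R m y) = 0) : FreelyGeneratesHom k Q R m G := by
  have key : ∀ g : G, ∃ φ : Chn k Q R m →ₗ[k] k, (∀ y, φ (bd k Q R m y) = 0) ∧
      ∀ l : G →₀ k, φ (Finsupp.linearCombination k (fun x : G => (x : Chn k Q R m)) l) = l g := by
    rintro ⟨g, hg⟩
    obtain ⟨φ, a1, a2, a3⟩ := h3 g hg
    refine ⟨φ, a3, fun l => ?_⟩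
    rw [Finsupp.linearCombination_apply, Finsupp.sum, map_sum, Finset.sum_eq_single ⟨g, hg⟩]
    · rw [map_smul, a1]; simp
    · rintro ⟨b, hb⟩ _ hne
      rw [map_smul, a2 b hb (fun h => hne (by simp [h]))]; simp
    · intro h
      rw [Finsupp.notMem_support_iff] at h
      rw [h]; simp
  refine ⟨h1, h2, ?_, ?_⟩
  · intro x hx hr
    have hx' : x ∈ Submodule.span k (Set.range (fun x : G => (x : Chn k Q R m))) := by simpa using hx
    obtain ⟨l, rfl⟩ := (Finsupp.mem_span_range_iff_exists_finsupp).1 hx'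
    have : l = 0 := by
      ext g
      obtain ⟨φ, b1, b2⟩ := key g
      obtain ⟨y, hy⟩ := hr
      have b3 := b2 l
      rw [Finsupp.linearCombination_apply, ← hy, b1] at b3
      exact b3.symm
    rw [this]; simp
  · rw [linearIndependent_iff]
    intro l hl
    ext g
    obtain ⟨φ, b1, b2⟩ := key g
    rw [← b2 l, hl]; simp

open Classical in
/-- functional dual to a class in its lower degree -/
noncomputable def fU (c : K.I) (w : List Q.A) : k :=
  if h : ∃ i, i < K.r c ∧ K.W c i = w then ep k Q R K c ^ h.choose else 0

theorem fU_W (c : K.I) (i : ℕ) (hi : i < K.r c) : fU k Q R K c (K.W c i) = ep k Q R K c ^ i := by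
  have h : ∃ j, j < K.r c ∧ K.W c j = K.W c i := ⟨i, hi, rfl⟩
  unfold fU
  rw [dif_pos h]
  have e := K.inj _ _ _ _ h.choose_spec.1 hi h.choose_spec.2
  rw [e.2]

theorem fU_ne (c c' : K.I) (hc : c' ≠ c) (i : ℕ) (hi : i < K.r c') :
    fU k Q R K c (K.W c' i) = 0 := by
  unfold fU
  rw [dif_neg]
  rintro ⟨j, hj, h⟩
  exact hc (K.inj _ _ _ _ hj hi h).1.symm

theorem lft_bet' (hq : IsQuadMon Q R) {m : ℕ} (fe : Q.V → k) (f : List Q.A → k) {w : List Q.A}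
    (h : f w = 0) : lft k Q R m fe f (bet k Q R m w) = 0 := by
  by_cases hv : VV Q R m w
  · rw [lft_bet k Q R hq fe f hv, h]
  · rw [bet_zero k Q R hq hv, map_zero]

theorem dual_part (hq : IsQuadMon Q R) (m : ℕ) (g : Chn k Q R m) (hg : g ∈ Gen k Q R K m) :
    ∃ φ : Chn k Q R m →ₗ[k] k, φ g = 1 ∧ (∀ g' ∈ Gen k Q R K m, g' ≠ g → φ g' = 0) ∧
      ∀ y, φ (bd k Q R m y) = 0 := by
  classical
  have red : ∀ φ : Chn k Q R m →ₗ[k] k, (∀ w, VV Q R (m+1) w →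
      φ (bet k Q R m w) + (-1)^(m+1) * φ (bet k Q R m (w.rotate 1)) = 0) →
      ∀ y, φ (bd k Q R m y) = 0 := by
    intro φ h y
    have := lin_ext_s16 k Q R hq (⊥ : Submodule k k) (φ.comp (bd k Q R m)) (by intro h; omega) (by
      intro w hw
      rw [LinearMap.comp_apply, bd_bet k Q R hq hw, map_add, map_smul, smul_eq_mul, h w hw]
      exact Submodule.zero_mem _) y
    exact (Submodule.mem_bot k).1 this
  have rotinj : ∀ (w : List Q.A) c j, w.rotate 1 = K.W c j → w = K.W c (j+1) := by
    intro w c j h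
    rw [← K.rot] at h
    exact List.rotate_injective 1 h
  rcases hg with (⟨rfl, e, rfl⟩ | ⟨c, hc, h, rfl⟩) | ⟨c, hc, h, rfl⟩
  · refine ⟨lft k Q R 0 (fun e' => if e' = e then 1 else 0) (fun _ => 0), ?_, ?_, ?_⟩
    · rw [lft_E]; simp
    · rintro g' ((⟨-, e', rfl⟩ | ⟨c, hc, h, rfl⟩) | ⟨c, hc, h, rfl⟩) hne
      · rw [lft_E, if_neg]
        rintro rfl
        exact hne rfl
      · exact lft_bet' k Q R hq _ _ rfl
      · omega
    · apply red
      intro w hw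
      rw [lft_bet' k Q R hq _ _ rfl, lft_bet' k Q R hq _ _ rfl]
      simp
  · refine ⟨lft k Q R m (fun _ => 0) (fU k Q R K c), ?_, ?_, ?_⟩
    · rw [lft_bet k Q R hq _ _ ((K.val _ _ _).2 (Or.inl hc.symm)), fU_W k Q R K c 0 (K.hr c),
        pow_zero]
    · rintro g' ((⟨rfl, e', rfl⟩ | ⟨c', hc', h', rfl⟩) | ⟨c', hc', h', rfl⟩) hne
      · rw [lft_E]
      · refine lft_bet' k Q R hq _ _ (fU_ne k Q R K c c' ?_ 0 (K.hr c'))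
        rintro rfl
        exact hne rfl
      · rw [map_sum]
        apply Finset.sum_eq_zero
        intro j hj
        rw [map_smul, lft_bet' k Q R hq _ _ (fU_ne k Q R K c c' ?_ j (Finset.mem_range.1 hj))]
        · simp
        · rintro rfl
          omega
    · apply red
      intro w hw
      by_cases hw' : ∃ j, j + 1 ≤ K.r c ∧ K.W c (j+1) = w
      · obtain ⟨j, hj, rfl⟩ := hw'
        rw [K.rot]
        have hv := fun j => (K.val c j m).2 (Or.inl hc.symm)
        rw [lft_bet k Q R hq _ _ (hv _), lft_bet k Q R hq _ _ (hv _), fU_W k Q R K c j hj]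
        have : fU k Q R K c (K.W c (j+1)) = ep k Q R K c ^ (j+1) := by
          rcases hj.lt_or_eq with h1 | h1
          · exact fU_W k Q R K c _ h1
          · rw [h1, K.per, fU_W k Q R K c 0 (K.hr c), h, pow_zero]
        rw [this, pow_succ, pow_succ, ← hc]
        unfold ep
        ring
      · have hn : ∀ v, (∀ j, j < K.r c → K.W c j ≠ v) → fU k Q R K c v = 0 := by
          intro v hv
          unfold fU
          rw [dif_neg]
          rintro ⟨j, hj, e⟩
          exact hv j hj e
        rw [lft_bet' k Q R hq _ _ (hn w _), lft_bet' k Q R hq _ _ (hn (w.rotate 1) _)]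
        · simp
        · intro j hj e
          exact hw' ⟨j, hj, (rotinj w c j e.symm).symm⟩
        · intro j hj e
          apply hw'
          rcases j with _ | j
          · exact ⟨K.r c - 1, by have := K.hr c; omega, by rw [Nat.sub_add_cancel (K.hr c), K.per, e]⟩
          · exact ⟨j, by omega, e⟩
  · have hf : ∀ c' j, j < K.r c' → (K.W c' j = K.W c 0 ↔ c' = c ∧ j = 0) := by
      intro c' j hj
      constructor
      · exact fun e => K.inj _ _ _ _ hj (K.hr c) e
      · rintro ⟨rfl, rfl⟩; rfl
    refine ⟨lft k Q R m (fun _ => 0) (fun w => if w = K.W c 0 then 1 else 0), ?_, ?_, ?_⟩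
    · rw [map_sum, Finset.sum_eq_single 0]
      · rw [map_smul, lft_bet k Q R hq _ _ ((K.val _ _ _).2 (Or.inr hc.symm))]
        simp
      · intro j hj hne
        rw [map_smul, lft_bet' k Q R hq, smul_zero]
        rw [if_neg]
        rw [hf c j (Finset.mem_range.1 hj)]
        exact fun h => hne h.2
      · intro h
        exact absurd (Finset.mem_range.2 (K.hr c)) h
    · rintro g' ((⟨rfl, e', rfl⟩ | ⟨c', hc', h', rfl⟩) | ⟨c', hc', h', rfl⟩) hne
      · rw [lft_E]
      · apply lft_bet' k Q R hq
        rw [if_neg]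
        rw [hf c' 0 (K.hr c')]
        rintro ⟨rfl, -⟩
        omega
      · rw [map_sum]
        apply Finset.sum_eq_zero
        intro j hj
        rw [map_smul, lft_bet' k Q R hq, smul_zero]
        rw [if_neg]
        rw [hf c' j (Finset.mem_range.1 hj)]
        rintro ⟨rfl, -⟩
        exact hne rfl
    · apply red
      intro w hw
      have hn : ∀ j, w ≠ K.W c j := by
        rintro j rfl
        rw [K.val] at hw
        omega
      rw [lft_bet' k Q R hq _ _ (if_neg (hn 0)), lft_bet' k Q R hq _ _ (if_neg
        (fun h => hn _ (rotinj w c 0 h)))]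
      simp

theorem abstract_main (hq : IsQuadMon Q R) (m : ℕ) :
    FreelyGeneratesHom k Q R m (Gen k Q R K m) :=
  fg_of k Q R m _ (cyc_part k Q R K hq m) (span_part k Q R K hq m) (dual_part k Q R K hq m)


end P4sec

section P5sec

variable (k : Type) [Field k] (Q : Quiv) (R : Set (Q.A × Q.A))

theorem T1 {c : PathDat Q} (hc : IsCycle Q c) : bw k Q R 0 (c, (c.1, [])) = bet k Q R 0 c.2 := by
  have h := (cyc_iff Q c).1 hc
  exact bw_eq k Q R rfl (by simpa using h.1) (by simpa using h.2.2) (by simpa using h.2.2)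

theorem T2 {c : PathDat Q} (hc : IsCycle Q c) : bw k Q R 1 (r1P Q c, r2P Q c) = bet k Q R 1 c.2 := by
  obtain ⟨h0, h1, h2⟩ := (cyc_iff Q c).1 hc
  obtain ⟨v, l⟩ := c
  obtain ⟨a, l, rfl⟩ := List.exists_cons_of_ne_nil h0
  simp only [r1P, r2P]
  refine bw_eq k Q R (x := ((Q.tgt a, l), (Q.src a, [a]))) rfl (by simp) ?_ (by simp)
  unfold CycS cmp at h1
  cases l with
  | nil => simpa [eq_comm] using h1
  | cons b l => simpa [eq_comm] using h1.1.rel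

theorem T3 {c : PathDat Q} (hc : IsCycle Q c) {m : ℕ} (hm : c.2.length = m) :
    bw k Q R m ((psrc Q c, []), c) = bet k Q R m c.2 := by
  have h := (cyc_iff Q c).1 hc
  have := bw_eq k Q R (x := ((psrc Q c, []), c)) hm (by simpa using h.1)
    (by simpa [psrc] using h.2.2) (by simpa using h.2.2)
  simpa using this

theorem T4 {c : PathDat Q} (hc : IsCycle Q c) {m : ℕ} (hm : c.2.length = m + 1) :
    bw k Q R m (l1P Q c, l2P Q c) = bet k Q R m c.2 := by
  obtain ⟨h0, h1, h2⟩ := (cyc_iff Q c).1 hc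
  obtain ⟨v, l⟩ := c
  rcases List.eq_nil_or_concat l with rfl | ⟨l, b, rfl⟩
  · simp at h0
  have := bw_eq k Q R (m := m) (x := ((Q.src b, [b]), (v, l))) (by simpa using hm) (by simp)
    (by simp) (by simpa using h2)
  simpa [l1P, l2P] using this

theorem rotI_one {a : Q.A} (i : ℕ) : rotI Q i (Q.src a, [a]) = (Q.src a, [a]) := by
  induction i with
  | zero => rfl
  | succ i ih => rw [rotI_succ, ih]; simp [rotP]

theorem loop_period {a : Q.A} : periodP Q (Q.src a, [a]) = 1 := by
  apply le_antisymm
  · exact Nat.sInf_le ⟨le_rfl, rotI_one Q 1⟩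
  · have : periodP Q (Q.src a, [a]) ∈ {i : ℕ | 1 ≤ i ∧ rotI Q i (Q.src a, [a]) = (Q.src a, [a])} :=
      Nat.sInf_mem ⟨1, le_rfl, rotI_one Q 1⟩
    exact this.1

theorem loop_iff (v : Q.V) (a : Q.A) : Complete Q R (v, [a]) ↔
    Q.src a = Q.tgt a ∧ (a, a) ∈ R ∧ v = Q.src a := by
  rw [complete_iff, cyc_iff, ← cycS_iff (by simp)]
  simp only [CycS, cmp, rl]
  simp
  constructor
  · rintro ⟨⟨h1, h2⟩, h3⟩
    exact ⟨h1.symm, h3, h2.symm⟩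
  · rintro ⟨h1, h2, h3⟩
    exact ⟨⟨h1.symm, h3.symm⟩, h2⟩

theorem loop_mem {Rg : Set (PathDat Q)} (hRg : IsRepSet Q Rg (Complete Q R)) {a : Q.A}
    (h1 : Q.src a = Q.tgt a) (h2 : (a, a) ∈ R) : (Q.src a, [a]) ∈ Rg := by
  obtain ⟨p, ⟨hp, i, hi⟩, -⟩ := hRg.2 _ ((loop_iff Q R (Q.src a) a).2 ⟨h1, h2, rfl⟩)
  rw [rotI_one] at hi
  rwa [hi]

theorem mk_spec (Rc Rg : Set (PathDat Q))
    (hRc : IsRepSet Q Rc (Cocomplete Q R)) (hRg : IsRepSet Q Rg (Complete Q R)) :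
    ∃ (ic : ∀ c, c ∈ Rc → (mkCls Q R Rc Rg hRc hRg).I)
      (ig : ∀ c, c ∈ Rg → (mkCls Q R Rc Rg hRc hRg).I),
      (∀ x, (∃ c h, x = ic c h) ∨ ∃ c h, x = ig c h) ∧
      (∀ c h, (mkCls Q R Rc Rg hRc hRg).D (ic c h) = 0) ∧
      (∀ c h, (mkCls Q R Rc Rg hRc hRg).D (ig c h) = c.2.length - 1) ∧
      (∀ c h, (mkCls Q R Rc Rg hRc hRg).r (ic c h) = periodP Q c) ∧
      (∀ c h, (mkCls Q R Rc Rg hRc hRg).r (ig c h) = periodP Q c) ∧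
      (∀ c h i, (mkCls Q R Rc Rg hRc hRg).W (ic c h) i = (rotI Q i c).2) ∧
      (∀ c h i, (mkCls Q R Rc Rg hRc hRg).W (ig c h) i = (rotI Q i c).2) := by
  classical
  have disj : ∀ c ∈ Rg, c ∉ Rc := by
    intro c h1 h2
    exact ((cocomplete_iff Q R c).1 (hRc.1 c h2)).2 0 (((complete_iff Q R c).1 (hRg.1 c h1)).2 0)
  refine ⟨fun c h => ⟨c, Or.inl h⟩, fun c h => ⟨c, Or.inr h⟩, ?_, fun c h => if_pos h,
    fun c h => if_neg (disj c h), fun _ _ => rfl, fun _ _ => rfl, fun _ _ _ => rfl, fun _ _ _ => rfl⟩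
  rintro ⟨c, hc | hc⟩
  · exact Or.inl ⟨c, hc, rfl⟩
  · exact Or.inr ⟨c, hc, rfl⟩

theorem gen_eq (Rc Rg : Set (PathDat Q))
    (hRc : IsRepSet Q Rc (Cocomplete Q R)) (hRg : IsRepSet Q Rg (Complete Q R)) (m : ℕ) :
    GenHom k Q R Rc Rg m = Gen k Q R (mkCls Q R Rc Rg hRc hRg) m := by
  classical
  obtain ⟨ic, ig, surj, Dc, Dg, Krc, Krg, KWc, KWg⟩ := mk_spec Q R Rc Rg hRc hRg
  generalize mkCls Q R Rc Rg hRc hRg = K at *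
  have KWc0 : ∀ c h, K.W (ic c h) 0 = c.2 := fun c h => KWc c h 0
  have KWg0 : ∀ c h, K.W (ig c h) 0 = c.2 := fun c h => KWg c h 0
  have epc : ∀ c (h : c ∈ Rc), ep k Q R K (ic c h) = 1 := by
    intro c h; unfold ep; rw [Dc c h, pow_zero]
  have epg : ∀ c (h : c ∈ Rg), ep k Q R K (ig c h) = (-1) ^ (c.2.length - 1) := by
    intro c h; unfold ep; rw [Dg c h]
  have sgn : ∀ n j : ℕ, (-1 : k) ^ ((n + 1 + 1) * j) = ((-1 : k) ^ n) ^ j := by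
    intro n j
    rw [pow_mul, pow_succ, pow_succ]; simp
  -- the values of the generators
  have hX : ∀ c (h : c ∈ Rg), c.2.length = m → hCycM k Q R m c =
      ∑ j ∈ Finset.range (K.r (ig c h)), ep k Q R K (ig c h) ^ j •
        bet k Q R m (K.W (ig c h) j) := by
    intro c h hl
    have hcy := (hRg.1 c h).1
    have hpos : 0 < c.2.length := List.length_pos_iff.2 hcy.2.1
    unfold hCycM
    rw [Krg]
    apply Finset.sum_congr rfl
    intro j _
    rw [KWg, T3 k Q R (rotI_cyc Q j c hcy) (by rw [rotI_len, hl]), epg]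
    obtain ⟨n, rfl⟩ : ∃ n, m = n + 1 := ⟨m - 1, by omega⟩
    rw [hl, sgn]
    rfl
  have hXc : ∀ c (h : c ∈ Rc), hCycR k Q R 1 c =
      ∑ j ∈ Finset.range (K.r (ic c h)), ep k Q R K (ic c h) ^ j •
        bet k Q R 1 (K.W (ic c h) j) := by
    intro c h
    have hcy := (hRc.1 c h).1
    unfold hCycR
    rw [Krc]
    apply Finset.sum_congr rfl
    intro j _
    rw [KWc, T2 k Q R (rotI_cyc Q j c hcy), epc, one_pow, one_smul]
  ext x
  constructor
  · rintro (((((((⟨rfl, e, rfl⟩ | ⟨rfl, c, hc, rfl⟩) | ⟨rfl, a, h1, h2, rfl⟩) | ⟨rfl, c, hc, rfl⟩) |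
      ⟨rfl, a, h1, h2, rfl⟩) | ⟨rfl, c, hc, hl, hs, rfl⟩) | ⟨hm, c, hc, hl, hs, rfl⟩) |
      ⟨hm, c, hc, hl, hs, rfl⟩)
    · exact Or.inl (Or.inl ⟨rfl, e, rfl⟩)
    · refine Or.inl (Or.inr ⟨ic c hc, Dc c hc, ?_, ?_⟩)
      · rw [epc, one_pow]
      · rw [KWc0, T1 k Q R (hRc.1 c hc).1]
    · have hc := loop_mem Q R hRg h1 h2
      refine Or.inl (Or.inr ⟨ig _ hc, Dg _ hc, ?_, ?_⟩)
      · rw [epg]; simp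
      · rw [KWg0, ← T1 k Q R (hRg.1 _ hc).1]
    · refine Or.inr ⟨ic c hc, by rw [Dc c hc], ?_, hXc c hc⟩
      rw [epc, one_pow]
    · have hc := loop_mem Q R hRg h1 h2
      refine Or.inr ⟨ig _ hc, by rw [Dg _ hc]; simp, ?_, ?_⟩
      · rw [epg]; simp
      · rw [← hX _ hc rfl]
        unfold hCycM
        rw [loop_period]
        simp [rotI, psrc]
    · have hl' : c.2.length = 2 := hl
      refine Or.inl (Or.inr ⟨ig c hc, by rw [Dg c hc, hl'], ?_, ?_⟩)
      · rw [epg, hl', Krg]; simpa using hs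
      · rw [KWg0, T4 k Q R (hRg.1 c hc).1 hl']
    · have hl' : c.2.length = m := hl
      refine Or.inr ⟨ig c hc, by rw [Dg c hc, hl']; omega, ?_, hX c hc hl⟩
      obtain ⟨n, rfl⟩ : ∃ n, m = n + 1 := ⟨m - 1, by omega⟩
      rw [epg, hl', Krg, Nat.add_sub_cancel, ← sgn]; exact hs
    · have hl' : c.2.length = m + 1 := hl
      refine Or.inl (Or.inr ⟨ig c hc, by rw [Dg c hc, hl']; omega, ?_, ?_⟩)
      · rw [epg, hl', Krg, Nat.add_sub_cancel, ← pow_mul]; exact hs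
      · rw [KWg0, T4 k Q R (hRg.1 c hc).1 hl']
  · rintro ((⟨rfl, e, rfl⟩ | ⟨y, hm, hs, rfl⟩) | ⟨y, hm, hs, rfl⟩)
    · left; left; left; left; left; left; left
      exact ⟨rfl, e, rfl⟩
    · rcases surj y with ⟨c, hc, rfl⟩ | ⟨c, hc, rfl⟩
      · left; left; left; left; left; left; right
        rw [Dc c hc] at hm
        subst hm
        exact ⟨rfl, c, hc, by rw [KWc0, T1 k Q R (hRc.1 c hc).1]⟩
      · have hcy := (hRg.1 c hc).1
        have hpos : 0 < c.2.length := List.length_pos_iff.2 hcy.2.1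
        rw [Dg c hc] at hm
        have hl : c.2.length = m + 1 := by omega
        rw [epg, hm, Krg, ← pow_mul] at hs
        rw [KWg0]
        rcases m with _ | _ | m
        · left; left; left; left; left; right
          obtain ⟨v, l⟩ := c
          obtain ⟨a, rfl⟩ := List.length_eq_one_iff.1 hl
          obtain ⟨h1, h2, rfl⟩ := (loop_iff Q R v a).1 (hRg.1 _ hc)
          exact ⟨rfl, a, h1, h2, (T1 k Q R hcy).symm⟩
        · left; left; right
          exact ⟨rfl, c, hc, hl, by simpa using hs, (T4 k Q R hcy hl).symm⟩
        · right
          exact ⟨by omega, c, hc, hl, hs, (T4 k Q R hcy hl).symm⟩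
    · rcases surj y with ⟨c, hc, rfl⟩ | ⟨c, hc, rfl⟩
      · left; left; left; left; right
        rw [Dc c hc] at hm
        subst hm
        exact ⟨rfl, c, hc, (hXc c hc).symm⟩
      · have hcy := (hRg.1 c hc).1
        have hpos : 0 < c.2.length := List.length_pos_iff.2 hcy.2.1
        rw [Dg c hc] at hm
        have hl : c.2.length = m := by omega
        rw [← hX c hc hl]
        rw [epg, hl, Krg] at hs
        rcases m with _ | _ | m
        · omega
        · left; left; left; right
          obtain ⟨v, l⟩ := c
          obtain ⟨a, rfl⟩ := List.length_eq_one_iff.1 hl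
          obtain ⟨h1, h2, rfl⟩ := (loop_iff Q R v a).1 (hRg.1 _ hc)
          refine ⟨rfl, a, h1, h2, ?_⟩
          unfold hCycM
          rw [loop_period]
          simp [rotI, psrc]
        · left; right
          rw [Nat.add_sub_cancel, ← sgn] at hs
          exact ⟨by omega, c, hc, hl, hs, rfl⟩


end P5sec

/-- For a quadratic monomial presentation `(Q, R)` and any
choice of representatives `Rc`, `Rg` of the cocomplete and complete circuits,
the Hochschild homology `HH_*(kQ/⟨R⟩)` — the homology of `k(B ⊙ Γ)` — is
freely spanned, in each degree `m`, by the homology classes of the elements of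
`GenHom … m` (the lists of Theorem `thm:basishomology`). -/
theorem hochschild_homology_basis (k : Type) [Field k] (Q : Quiv)
    (R : Set (Q.A × Q.A)) (hq : IsQuadMon Q R) (Rc Rg : Set (PathDat Q))
    (hRc : IsRepSet Q Rc (Cocomplete Q R)) (hRg : IsRepSet Q Rg (Complete Q R)) :
    ∀ m : ℕ, FreelyGeneratesHom k Q R m (GenHom k Q R Rc Rg m) := by
  intro m
  rw [gen_eq k Q R Rc Rg hRc hRg m]
  exact abstract_main k Q R _ hq m

end GentleTT
end
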